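/- Fix n ∈ ℕ and 0 < δ ≪ 1, and set θ = 1 − n + 1/ln b + ᾱ. For ζ₀ > 0 small enough there exist b* > 0 and a universal constant C > 0 such that for all 0 < b ≤ b* and all ᾱ with |ᾱ| ≤ C₀/(ln b)², there exists a smooth solution q on [z₀, ∞), z₀ = ζ₀²/2, of the equation z q'' + (2 − z) q' − θ q − (2b/(b+2z)) q' + (4b/(b+2z)²) q = 0, of the form q(z) = Γ(θ) h_θ(z) + 𝒢(z) with sup_{z ≥ z₀} ⟨z⟩^{θ−δ} (|𝒢(z)| + z|𝒢'(z)| + z²|𝒢''(z)|) ≤ C' b |ln b|^C for some C' depending on z₀. Moreover, on [z₀, ∞), q has no zero when n = 0 or n = 1, and q has exactly n − 1 zeros when n ≥ 2. -/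

import Mathlib

open Real Set

/-- The Japanese bracket `⟨z⟩ = √(1+z²)`. -/
noncomputable def jap (z : ℝ) : ℝ := Real.sqrt (1 + z ^ 2)

/-- The digamma function `Ψ = Γ'/Γ`. -/
noncomputable def digamma (x : ℝ) : ℝ := deriv Real.Gamma x / Real.Gamma x

/-- Coefficients of Kummer's series: `(θ)_i / ((2)_i i!)`. -/
noncomputable def kummerCoeff (θ : ℝ) (i : ℕ) : ℝ :=
  (ascPochhammer ℝ i).eval θ / ((ascPochhammer ℝ i).eval 2 * (i.factorial : ℝ))

/-- Kummer's singular solution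
`h_θ(z) = 1/(zΓ(θ)) + (1/Γ(θ−1)) Σ_i ((θ)_i/((2)_i i!)) z^i [ln z + Ψ(θ+i) − Ψ(1+i) − Ψ(2+i)]`. -/
noncomputable def hKum (θ z : ℝ) : ℝ :=
  1 / (z * Real.Gamma θ)
    + (1 / Real.Gamma (θ - 1))
        * ∑' i : ℕ, kummerCoeff θ i * z ^ i
            * (Real.log z + digamma (θ + i) - digamma (1 + i) - digamma (2 + i))

section Helpers
open Filter Topology


lemma aux_compare (a : ℝ) (F f g k : ℝ → ℝ)
    (hF : ∀ t, a ≤ t → HasDerivAt F (-f t) t) (hg : ∀ t, a ≤ t → HasDerivAt g (-k t) t)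
    (hfk : ∀ t, a ≤ t → |f t| ≤ k t) (F0 : Tendsto F atTop (𝓝 0)) (g0 : Tendsto g atTop (𝓝 0)) :
    ∀ t, a ≤ t → |F t| ≤ g t := by
  have key : ∀ (u u' : ℝ → ℝ), (∀ t, a ≤ t → HasDerivAt u (u' t) t) → (∀ t, a ≤ t → u' t ≤ 0) →
      Tendsto u atTop (𝓝 0) → ∀ t, a ≤ t → 0 ≤ u t := by
    intro u u' hu hu' h0 t ht
    have anti : AntitoneOn u (Ici a) := by
      apply antitoneOn_of_deriv_nonpos (convex_Ici a)
      · intro x hx; exact (hu x hx).continuousAt.continuousWithinAt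
      · intro x hx; rw [interior_Ici] at hx
        exact (hu x (le_of_lt hx)).differentiableAt.differentiableWithinAt
      · intro x hx; rw [interior_Ici] at hx
        rw [(hu x (le_of_lt hx)).deriv]; exact hu' x (le_of_lt hx)
    apply le_of_tendsto h0
    filter_upwards [eventually_ge_atTop t] with s hs
    exact anti ht (le_trans ht hs) hs
  intro t ht
  rw [abs_le]
  constructor
  · have := key (fun t => g t + F t) (fun t => -k t + -f t) (fun t ht => (hg t ht).add (hF t ht))
      (fun t ht => by have := (abs_le.1 (hfk t ht)).1; linarith) (by simpa using g0.add F0) t ht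
    linarith
  · have := key (fun t => g t - F t) (fun t => -k t - -f t) (fun t ht => (hg t ht).sub (hF t ht))
      (fun t ht => by have := (abs_le.1 (hfk t ht)).2; linarith) (by simpa using g0.sub F0) t ht
    linarith

lemma aux_tail (a : ℝ) (f g k : ℝ → ℝ) (hf : Continuous f)
    (hg : ∀ t, a ≤ t → HasDerivAt g (-k t) t)
    (hfk : ∀ t, a ≤ t → |f t| ≤ k t) (g0 : Tendsto g atTop (𝓝 0)) :
    ∃ F : ℝ → ℝ, (∀ t, HasDerivAt F (-f t) t) ∧ Tendsto F atTop (𝓝 0) := by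
  have hk : MeasureTheory.IntegrableOn (fun t => -k t) (Ioi a) MeasureTheory.volume := by
    apply MeasureTheory.integrableOn_Ioi_deriv_of_nonpos (g := g) (l := 0)
    · exact (hg a le_rfl).continuousAt.continuousWithinAt
    · intro x hx; exact hg x (le_of_lt hx)
    · intro x hx; have := (abs_nonneg _).trans (hfk x (le_of_lt hx)); linarith
    · exact g0
  have hfi : MeasureTheory.IntegrableOn f (Ioi a) MeasureTheory.volume := by
    apply MeasureTheory.Integrable.mono' hk.neg hf.aestronglyMeasurable
    refine (MeasureTheory.ae_restrict_iff' measurableSet_Ioi).2 (Eventually.of_forall ?_)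
    intro x hx; simpa using hfk x (le_of_lt hx)
  refine ⟨fun t => (∫ s in Ioi a, f s) - ∫ s in a..t, f s, ?_, ?_⟩
  · intro t
    have := (hasDerivAt_const t (∫ s in Ioi a, f s)).sub
      (intervalIntegral.integral_hasDerivAt_right (hf.intervalIntegrable a t)
        hf.stronglyMeasurable.stronglyMeasurableAtFilter hf.continuousAt)
    exact this.congr_deriv (by simp)
  · have := MeasureTheory.intervalIntegral_tendsto_integral_Ioi a hfi tendsto_id
    simpa using (tendsto_const_nhds (x := ∫ s in Ioi a, f s)).sub this

/-- majorant -/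
noncomputable def mW (l s : ℝ) : ℝ := exp (l / s) / s ^ 2

lemma mW_pos (l s : ℝ) (hs : 0 < s) : 0 < mW l s := by unfold mW; positivity

lemma hasDerivAt_expdiv (l s : ℝ) (hs : 0 < s) :
    HasDerivAt (fun s => exp (l / s)) (-(l * mW l s)) s := by
  have h1 : HasDerivAt (fun s => l / s) (-l / s ^ 2) s := by
    have := (hasDerivAt_inv hs.ne').const_mul l
    exact this.congr_deriv (by field_simp)
  exact h1.exp.congr_deriv (by unfold mW; field_simp)

lemma hasDerivAt_emW (l s : ℝ) (hs : 0 < s) :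
    HasDerivAt (fun s => exp (-s) * mW l s)
      (-(exp (-s) * (exp (l / s) * (1 / s ^ 2 + 2 / s ^ 3 + l / s ^ 4)))) s := by
  have h1 := hasDerivAt_expdiv l s hs
  have h2 : HasDerivAt (fun s : ℝ => s ^ 2) (2 * s) s := by simpa using hasDerivAt_pow 2 s
  have h3 : HasDerivAt (fun s : ℝ => exp (-s)) (-exp (-s)) s := by
    simpa using (hasDerivAt_neg s).exp
  have h4 := h3.mul (h1.div h2 (by positivity))
  exact h4.congr_deriv (by unfold mW; simp only [Pi.div_apply]; field_simp; ring)

lemma tendsto_div_zero (l : ℝ) : Tendsto (fun s : ℝ => l / s) atTop (𝓝 0) :=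
  tendsto_const_nhds.div_atTop tendsto_id

lemma tendsto_mW (l : ℝ) : Tendsto (mW l) atTop (𝓝 0) := by
  unfold mW
  have h1 : Tendsto (fun s : ℝ => exp (l / s)) atTop (𝓝 (exp 0)) :=
    (continuous_exp.tendsto 0).comp (tendsto_div_zero l)
  exact h1.div_atTop (tendsto_pow_atTop (by norm_num))

lemma tendsto_expdiv (l : ℝ) : Tendsto (fun s : ℝ => exp (l / s)) atTop (𝓝 1) := by
  have h1 : Tendsto (fun s : ℝ => exp (l / s)) atTop (𝓝 (exp 0)) :=
    (continuous_exp.tendsto 0).comp (tendsto_div_zero l)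
  simpa using h1

lemma tendsto_emW (l : ℝ) : Tendsto (fun s => exp (-s) * mW l s) atTop (𝓝 0) := by
  simpa using (tendsto_exp_neg_atTop_nhds_zero).mul (tendsto_mW l)

/-- w-bound from v-bound -/
lemma aux_w (a l N ll : ℝ) (ha : 0 < a) (hl : 0 < l) (w v : ℝ → ℝ)
    (hw : ∀ t, a ≤ t → HasDerivAt w (v t) t) (hlim : Tendsto w atTop (𝓝 ll))
    (hv : ∀ t, a ≤ t → |v t| ≤ N * mW l t) :
    ∀ t, a ≤ t → |w t - ll| ≤ N * ((exp (l / t) - 1) / l) := by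
  have hl' := hl.ne'
  apply aux_compare a (fun t => w t - ll) (fun t => - v t) _ (fun t => N * mW l t)
  · intro t ht; simpa using (hw t ht).sub_const ll
  · intro t ht
    have := ((((hasDerivAt_expdiv l t (ha.trans_le ht)).sub_const 1).div_const l).const_mul N)
    exact this.congr_deriv (by field_simp)
  · intro t ht; simpa using hv t ht
  · simpa using hlim.sub_const ll
  · simpa using ((((tendsto_expdiv l).sub_const 1).div_const l).const_mul N)

lemma aux_alg (C s : ℝ) (hC : 1 ≤ C) (hs : 0 < s) :
    C / s ^ 3 + C / s ^ 2 / (4 * C ^ 2) ≤ (1 / 2) * (1 / s ^ 2 + 2 / s ^ 3 + (4 * C ^ 2) / s ^ 4) := by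
  have h1 : C / s ^ 2 / (4 * C ^ 2) = (1 / s^2) * (1 / (4 * C)) := by field_simp
  have h2 : 1 / (4 * C) ≤ 1 / 4 := by
    apply one_div_le_one_div_of_le <;> linarith
  have h3 : C / s^3 ≤ (1/4) * (1 / s^2 + 4 * C^2 / s^4) := by
    have : (1/4) * (1 / s^2 + 4 * C^2 / s^4) - C / s^3 = (1/4) * (1 / s - 2 * C / s^2)^2 := by
      field_simp; ring
    nlinarith [sq_nonneg (1 / s - 2 * C / s^2)]
  have h4 : (1 / s^2) * (1 / (4 * C)) ≤ (1 / s^2) * (1/4) := by gcongr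
  have h5 : 0 < 1 / s^2 := by positivity
  have h6 : 0 < 2 / s^3 := by positivity
  have h7 : 0 < (4 * C ^ 2) / s ^ 4 := by positivity
  rw [h1]; linarith

/-- bound of the source -/
lemma aux_source (C s N G ll c r v w g : ℝ) (hC : 1 ≤ C) (hs : 0 < s) (hN : 0 ≤ N) (hG : 0 ≤ G)
    (hc : |c| ≤ C / s) (hr : |r| ≤ C / s ^ 2) (hg : |g| ≤ G / s ^ 2)
    (hv : |v| ≤ N * mW (4 * C ^ 2) s) (hw : |w - ll| ≤ N * ((exp (4 * C ^ 2 / s) - 1) / (4 * C ^ 2))) :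
    |c * v + r * w + g| ≤ (N / 2 + (C * |ll| + G)) *
      (exp (4 * C ^ 2 / s) * (1 / s ^ 2 + 2 / s ^ 3 + (4 * C ^ 2) / s ^ 4)) := by
  set e := exp (4 * C ^ 2 / s) with he
  have he1 : 1 ≤ e := by rw [he]; apply one_le_exp; positivity
  have h1 : |c * v| ≤ C / s * (N * (e / s^2)) := by
    rw [abs_mul]; apply mul_le_mul hc hv (abs_nonneg _) (by positivity)
  have hw' : |w| ≤ |ll| + N * (e / (4 * C^2)) := by
    have : |w| ≤ |w - ll| + |ll| := by simpa using abs_add_le (w - ll) ll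
    have h2 : N * ((e - 1) / (4 * C ^ 2)) ≤ N * (e / (4 * C^2)) := by gcongr; linarith
    linarith
  have h2 : |r * w| ≤ C / s^2 * (|ll| + N * (e / (4 * C^2))) := by
    rw [abs_mul]; apply mul_le_mul hr hw' (abs_nonneg _) (by positivity)
  have h3 : |c * v + r * w + g| ≤ |c * v| + |r * w| + |g| := abs_add_three _ _ _
  have h4 := aux_alg C s hC hs
  have h5 : e * N * (C / s ^ 3 + C / s ^ 2 / (4 * C ^ 2)) ≤ e * N * ((1 / 2) * (1 / s ^ 2 + 2 / s ^ 3 + (4 * C ^ 2) / s ^ 4)) := by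
    gcongr
  have h6 : C / s * (N * (e / s^2)) + C / s^2 * (N * (e / (4 * C^2))) = e * N * (C / s ^ 3 + C / s ^ 2 / (4 * C ^ 2)) := by
    field_simp
  have h7 : (C * |ll| + G) * (1 / s^2) ≤ (C * |ll| + G) * (e * (1 / s ^ 2 + 2 / s ^ 3 + (4 * C ^ 2) / s ^ 4)) := by
    apply mul_le_mul_of_nonneg_left _ (by positivity)
    have : 0 ≤ 2 / s ^ 3 + (4 * C ^ 2) / s ^ 4 := by positivity
    have h8 : 0 < 1 / s^2 := by positivity
    nlinarith
  have h8 : (C * |ll| + G) * (1 / s^2) = C / s^2 * |ll| + G / s^2 := by field_simp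
  nlinarith

/-- one improvement step -/
lemma aux_step (a C G N ll : ℝ) (ha : 0 < a) (hC : 1 ≤ C) (hG : 0 ≤ G) (hN : 0 ≤ N)
    (c r g w v : ℝ → ℝ)
    (hc : ∀ s, a ≤ s → |c s| ≤ C / s) (hr : ∀ s, a ≤ s → |r s| ≤ C / s ^ 2)
    (hg : ∀ s, a ≤ s → |g s| ≤ G / s ^ 2)
    (hw : ∀ t, a ≤ t → |w t - ll| ≤ N * ((exp (4 * C ^ 2 / t) - 1) / (4 * C ^ 2)))
    (hv : ∀ t, a ≤ t → |v t| ≤ N * mW (4 * C ^ 2) t)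
    (V : ℝ → ℝ) (V0 : Tendsto (fun t => exp (-t) * V t) atTop (𝓝 0))
    (hV : ∀ t, a ≤ t → HasDerivAt V (V t - (c t * v t + r t * w t + g t)) t) :
    ∀ t, a ≤ t → |V t| ≤ (N / 2 + (C * |ll| + G)) * mW (4 * C ^ 2) t := by
  intro t ht
  have := aux_compare a (fun t => exp (-t) * V t) (fun t => exp (-t) * (c t * v t + r t * w t + g t))
    (fun t => (N / 2 + (C * |ll| + G)) * (exp (-t) * mW (4 * C ^ 2) t))
    (fun s => (N / 2 + (C * |ll| + G)) * (exp (-s) * (exp (4 * C ^ 2 / s) * (1 / s ^ 2 + 2 / s ^ 3 + (4 * C ^ 2) / s ^ 4))))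
    (fun t ht => by
      have h3 : HasDerivAt (fun s : ℝ => exp (-s)) (-exp (-t)) t := by
        simpa using (hasDerivAt_neg t).exp
      exact (h3.mul (hV t ht)).congr_deriv (by ring))
    (fun t ht => by
      exact ((hasDerivAt_emW (4 * C ^ 2) t (ha.trans_le ht)).const_mul (N / 2 + (C * |ll| + G))).congr_deriv (by ring))
    (fun t ht => by
      have := aux_source C t N G ll (c t) (r t) (v t) (w t) (g t) hC (ha.trans_le ht) hN hG (hc t ht) (hr t ht) (hg t ht)
        (hv t ht) (hw t ht)
      rw [abs_mul, abs_of_pos (exp_pos _)]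
      have h2 := mul_le_mul_of_nonneg_left this (exp_pos (-t)).le
      linarith)
    V0 (by simpa using (tendsto_emW (4 * C ^ 2)).const_mul (N / 2 + (C * |ll| + G))) t ht
  simp only [abs_mul, abs_of_pos (exp_pos _)] at this
  have h2 : exp (-t) * |V t| ≤ exp (-t) * ((N / 2 + (C * |ll| + G)) * mW (4 * C ^ 2) t) := by linarith
  exact le_of_mul_le_mul_left h2 (exp_pos _)

/-- A priori estimate -/
lemma aux_est (a C G ll : ℝ) (ha : 0 < a) (hC : 1 ≤ C) (hG : 0 ≤ G)
    (c r g w v : ℝ → ℝ)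
    (hc : ∀ s, a ≤ s → |c s| ≤ C / s) (hr : ∀ s, a ≤ s → |r s| ≤ C / s ^ 2)
    (hg : ∀ s, a ≤ s → |g s| ≤ G / s ^ 2)
    (hw : ∀ t, a ≤ t → HasDerivAt w (v t) t) (hlim : Tendsto w atTop (𝓝 ll))
    (hv : ∀ t, a ≤ t → HasDerivAt v (v t - (c t * v t + r t * w t + g t)) t)
    (hvb : ∃ N : ℝ, ∀ t, a ≤ t → |v t| ≤ N / t ^ 2) :
    ∀ t, a ≤ t → |v t| ≤ (2 * (C * |ll| + G)) * mW (4 * C ^ 2) t ∧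
      |w t - ll| ≤ (2 * (C * |ll| + G)) * ((exp (4 * C ^ 2 / t) - 1) / (4 * C ^ 2)) := by
  have hB : 0 ≤ C * |ll| + G := by positivity
  obtain ⟨N, hN⟩ := hvb
  have hN0 : 0 ≤ N := by
    have := (abs_nonneg _).trans (hN a le_rfl)
    by_contra h
    have : N / a^2 < 0 := div_neg_of_neg_of_pos (not_le.1 h) (by positivity)
    linarith
  have V0 : Tendsto (fun t => exp (-t) * v t) atTop (𝓝 0) := by
    have h1 : Tendsto v atTop (𝓝 0) := by
      have h2 : Tendsto (fun t : ℝ => N / t ^ 2) atTop (𝓝 0) :=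
        tendsto_const_nhds.div_atTop (tendsto_pow_atTop (by norm_num))
      apply squeeze_zero_norm' _ h2
      filter_upwards [eventually_ge_atTop a] with t ht
      exact hN t ht
    simpa using tendsto_exp_neg_atTop_nhds_zero.mul h1
  have step : ∀ N, 0 ≤ N → (∀ t, a ≤ t → |v t| ≤ N * mW (4 * C ^ 2) t) →
      ∀ t, a ≤ t → |v t| ≤ (N / 2 + (C * |ll| + G)) * mW (4 * C ^ 2) t := by
    intro N hN0 hN
    exact aux_step a C G N ll ha hC hG hN0 c r g w v hc hr hg
      (aux_w a _ N ll ha (by positivity) w v hw hlim hN) hN v V0 hv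
  have start : ∀ t, a ≤ t → |v t| ≤ N * mW (4 * C ^ 2) t := by
    intro t ht
    have htp := ha.trans_le ht
    refine (hN t ht).trans ?_
    unfold mW
    rw [div_eq_mul_one_div N]
    gcongr
    apply one_le_exp; positivity
  have iter : ∀ k : ℕ, ∀ t, a ≤ t → |v t| ≤ (2 * (C * |ll| + G) + N * (1/2) ^ k) * mW (4 * C ^ 2) t := by
    intro k
    induction k with
    | zero =>
      intro t ht
      refine (start t ht).trans ?_
      have := mW_pos (4 * C^2) t (ha.trans_le ht)
      gcongr; simp; linarith
    | succ k ih =>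
      intro t ht
      refine (step _ (by positivity) ih t ht).trans (le_of_eq ?_)
      ring
  have fin : ∀ t, a ≤ t → |v t| ≤ (2 * (C * |ll| + G)) * mW (4 * C ^ 2) t := by
    intro t ht
    have h1 : Tendsto (fun k : ℕ => (2 * (C * |ll| + G) + N * (1/2) ^ k) * mW (4 * C ^ 2) t) atTop
        (𝓝 ((2 * (C * |ll| + G) + N * 0) * mW (4 * C ^ 2) t)) :=
      ((tendsto_const_nhds.add ((tendsto_pow_atTop_nhds_zero_of_lt_one (by norm_num) (by norm_num)).const_mul N)).mul_const _)
    have := ge_of_tendsto' h1 (fun k => iter k t ht)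
    simpa using this
  intro t ht
  exact ⟨fin t ht, aux_w a _ _ ll ha (by positivity) w v hw hlim fin t ht⟩


lemma continuousOn_mW (l a : ℝ) (ha : 0 < a) : ContinuousOn (mW l) (Ici a) := by
  intro s hs
  have hs' : 0 < s := ha.trans_le hs
  unfold mW
  apply ContinuousAt.continuousWithinAt
  apply ContinuousAt.div
  · exact (hasDerivAt_expdiv l s hs').continuousAt
  · fun_prop
  · positivity

lemma mW_le (l a t : ℝ) (hl : 0 ≤ l) (ha : 0 < a) (ht : a ≤ t) : mW l t ≤ exp (l / a) / t ^ 2 := by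
  unfold mW
  have := ha.trans_le ht
  gcongr

lemma aux_exist (a C : ℝ) (ha : 0 < a) (hC : 1 ≤ C) (c r : ℝ → ℝ)
    (hcc : ContinuousOn c (Ici a)) (hrc : ContinuousOn r (Ici a))
    (hc : ∀ s, a ≤ s → |c s| ≤ C / s) (hr : ∀ s, a ≤ s → |r s| ≤ C / s ^ 2) :
    ∃ w v : ℝ → ℝ, (∀ t, a ≤ t → HasDerivAt w (v t) t) ∧
      (∀ t, a ≤ t → HasDerivAt v (v t - (c t * v t + r t * w t)) t) ∧
      Tendsto w atTop (𝓝 1) ∧ ∃ N : ℝ, ∀ t, a ≤ t → |v t| ≤ N / t ^ 2 := by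
  set l := 4 * C ^ 2 with hl
  have hlpos : 0 < l := by positivity
  set σ : ℝ → ℝ := fun t => max t a with hσ
  have σc : Continuous σ := by fun_prop
  have σa : ∀ t, σ t ∈ Ici a := fun t => mem_Ici.2 (le_max_right t a)
  have σe : ∀ t, a ≤ t → σ t = t := fun t ht => max_eq_left ht
  have ctc : Continuous (fun t => c (σ t)) := hcc.comp_continuous σc σa
  have rtc : Continuous (fun t => r (σ t)) := hrc.comp_continuous σc σa
  have mtc : Continuous (fun t => mW l (σ t)) := (continuousOn_mW l a ha).comp_continuous σc σa
  have mtp : ∀ t, 0 < mW l (σ t) := fun t => mW_pos l _ (ha.trans_le (σa t))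
  have hc' : ∀ s, a ≤ s → |c (σ s)| ≤ C / s := fun s hs => by rw [σe s hs]; exact hc s hs
  have hr' : ∀ s, a ≤ s → |r (σ s)| ≤ C / s ^ 2 := fun s hs => by rw [σe s hs]; exact hr s hs
  have hvy : ∀ y : BoundedContinuousFunction ℝ ℝ, ∀ t, a ≤ t →
      |mW l (σ t) * y t| ≤ ‖y‖ * mW l t := by
    intro y t ht
    rw [abs_mul, abs_of_pos (mtp t), σe t ht, mul_comm]
    exact mul_le_mul_of_nonneg_right (y.norm_coe_le_norm t) (σe t ht ▸ mtp t).le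
  have step1 : ∀ y : BoundedContinuousFunction ℝ ℝ, ∃ w F : ℝ → ℝ,
      (∀ t, HasDerivAt w (mW l (σ t) * y t) t) ∧ Tendsto w atTop (𝓝 1) ∧
      (∀ t, HasDerivAt F (F t - (c (σ t) * (mW l (σ t) * y t) + r (σ t) * w t)) t) ∧
      Tendsto (fun t => exp (-t) * F t) atTop (𝓝 0) := by
    intro y
    obtain ⟨W, hW, W0⟩ := aux_tail a (fun t => mW l (σ t) * y t)
      (fun t => ‖y‖ * ((exp (l / t) - 1) / l)) (fun t => ‖y‖ * mW l t) (mtc.mul y.continuous)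
      (fun t ht => (((((hasDerivAt_expdiv l t (ha.trans_le ht)).sub_const 1).div_const l).const_mul ‖y‖)).congr_deriv
        (by field_simp))
      (hvy y) (by simpa using ((((tendsto_expdiv l).sub_const 1).div_const l).const_mul ‖y‖))
    have hw : ∀ t, HasDerivAt (fun t => 1 - W t) (mW l (σ t) * y t) t := fun t =>
      ((hW t).const_sub 1).congr_deriv (by simp)
    have hw1 : Tendsto (fun t => 1 - W t) atTop (𝓝 1) := by simpa using W0.const_sub 1
    have hwb := aux_w a l ‖y‖ 1 ha hlpos (fun t => 1 - W t) (fun t => mW l (σ t) * y t)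
      (fun t _ => hw t) hw1 (hvy y)
    have wc : Continuous W := continuous_iff_continuousAt.2 fun t => (hW t).continuousAt
    obtain ⟨F0, hF0, F00⟩ := aux_tail a
      (fun t => exp (-t) * (c (σ t) * (mW l (σ t) * y t) + r (σ t) * (1 - W t)))
      (fun t => (‖y‖ / 2 + (C * |1| + 0)) * (exp (-t) * mW l t))
      (fun s => (‖y‖ / 2 + (C * |1| + 0)) * (exp (-s) * (exp (l / s) * (1 / s ^ 2 + 2 / s ^ 3 + l / s ^ 4))))
      ((continuous_exp.comp continuous_neg).mul ((ctc.mul (mtc.mul y.continuous)).add (rtc.mul (continuous_const.sub wc))))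
      (fun t ht => ((hasDerivAt_emW l t (ha.trans_le ht)).const_mul _).congr_deriv (by ring))
      (fun t ht => by
        have := aux_source C t ‖y‖ 0 1 (c (σ t)) (r (σ t)) (mW l (σ t) * y t) (1 - W t) 0 hC
          (ha.trans_le ht) (norm_nonneg _) le_rfl (hc' t ht) (hr' t ht) (by simp)
          (hvy y t ht) (hwb t ht)
        rw [abs_mul, abs_of_pos (exp_pos _)]
        have h2 := mul_le_mul_of_nonneg_left this (exp_pos (-t)).le
        rw [add_zero] at h2
        linarith)
      (by simpa using (tendsto_emW l).const_mul (‖y‖ / 2 + (C * |1| + 0)))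
    refine ⟨fun t => 1 - W t, fun t => exp t * F0 t, hw, hw1, ?_, ?_⟩
    · intro t
      refine ((Real.hasDerivAt_exp t).mul (hF0 t)).congr_deriv ?_
      have : exp t * exp (-t) = 1 := by rw [← exp_add]; simp
      linear_combination (-(c (σ t) * (mW l (σ t) * y t) + r (σ t) * (1 - W t))) * this
    · refine F00.congr fun t => ?_
      rw [← mul_assoc, ← exp_add]; simp
  choose w F hw hw1 hF hF0 using step1
  have bnd : ∀ y : BoundedContinuousFunction ℝ ℝ, ∀ t, a ≤ t →
      |F y t| ≤ (‖y‖ / 2 + (C * |1| + 0)) * mW l t := by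
    intro y
    exact aux_step a C 0 ‖y‖ 1 ha hC le_rfl (norm_nonneg _) (fun t => c (σ t)) (fun t => r (σ t))
      (fun _ => 0) (w y) (fun t => mW l (σ t) * y t) hc' hr' (by simp)
      (aux_w a l ‖y‖ 1 ha hlpos _ _ (fun t _ => hw y t) (hw1 y) (hvy y)) (hvy y) (F y) (hF0 y)
      (fun t _ => by simpa using hF y t)
  have dif : ∀ y y' : BoundedContinuousFunction ℝ ℝ, ∀ t, a ≤ t →
      |F y t - F y' t| ≤ (‖y - y'‖ / 2) * mW l t := by
    intro y y'
    have hd : ∀ t, HasDerivAt (fun t => w y t - w y' t) (mW l (σ t) * (y - y') t) t := fun t =>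
      ((hw y t).sub (hw y' t)).congr_deriv (by simp; ring)
    have := aux_step a C 0 ‖y - y'‖ 0 ha hC le_rfl (norm_nonneg _) (fun t => c (σ t)) (fun t => r (σ t))
      (fun _ => 0) (fun t => w y t - w y' t) (fun t => mW l (σ t) * (y - y') t) hc' hr' (by simp)
      (aux_w a l ‖y - y'‖ 0 ha hlpos _ _ (fun t _ => hd t) (by simpa using (hw1 y).sub (hw1 y')) (hvy (y - y')))
      (hvy (y - y')) (fun t => F y t - F y' t) (by
        have := (hF0 y).sub (hF0 y')
        simp only [sub_zero] at this
        exact this.congr fun t => by ring)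
      (fun t _ => ((hF y t).sub (hF y' t)).congr_deriv (by simp; ring))
    simpa using this
  have Fc : ∀ y, Continuous (F y) := fun y => continuous_iff_continuousAt.2 fun t => (hF y t).continuousAt
  let S : BoundedContinuousFunction ℝ ℝ → BoundedContinuousFunction ℝ ℝ := fun y =>
    BoundedContinuousFunction.ofNormedAddCommGroup (fun t => F y (σ t) / mW l (σ t))
      (((Fc y).comp σc).div mtc (fun t => (mtp t).ne')) (‖y‖ / 2 + (C * |1| + 0)) (by
        intro t
        rw [Real.norm_eq_abs, abs_div, abs_of_pos (mtp t), div_le_iff₀ (mtp t)]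
        exact bnd y (σ t) (σa t))
  have hS : ContractingWith (1/2) S := by
    refine ⟨by rw [← NNReal.coe_lt_coe]; norm_num, LipschitzWith.of_dist_le_mul ?_⟩
    intro y y'
    rw [BoundedContinuousFunction.dist_le (by positivity)]
    intro t
    simp only [S, BoundedContinuousFunction.coe_ofNormedAddCommGroup]
    rw [Real.dist_eq, ← sub_div, abs_div, abs_of_pos (mtp t), div_le_iff₀ (mtp t)]
    have := dif y y' (σ t) (σa t)
    rw [dist_eq_norm]
    refine this.trans (le_of_eq ?_)
    push_cast; ring
  obtain ⟨y, hy⟩ : ∃ y, S y = y := ⟨hS.fixedPoint, hS.fixedPoint_isFixedPt⟩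
  have hvF : ∀ t, a ≤ t → mW l (σ t) * y t = F y t := by
    intro t ht
    have : S y t = y t := by rw [hy]
    simp only [S, BoundedContinuousFunction.coe_ofNormedAddCommGroup] at this
    rw [← this, mul_div_cancel₀ _ (mtp t).ne', σe t ht]
  refine ⟨w y, F y, ?_, ?_, hw1 y, (‖y‖ / 2 + (C * |1| + 0)) * exp (l / a), ?_⟩
  · intro t ht; rw [← hvF t ht]; exact hw y t
  · intro t ht
    have := hF y t
    rwa [hvF t ht, σe t ht] at this
  · intro t ht
    refine (bnd y t ht).trans ?_
    rw [mul_div_assoc]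
    exact mul_le_mul_of_nonneg_left (mW_le l a t hlpos.le ha ht) (by positivity)


noncomputable def cT (θ b z : ℝ) : ℝ := (2 - 2 * θ) / z - 2 * b / (z * (b + 2 * z))
noncomputable def rT (θ b z : ℝ) : ℝ :=
  θ * (θ - 1) / z ^ 2 + 4 * b / (z * (b + 2 * z) ^ 2) + 2 * b * θ / (z ^ 2 * (b + 2 * z))

structure IsSol (a θ b : ℝ) (w v : ℝ → ℝ) : Prop where
  dw : ∀ t, a ≤ t → HasDerivAt w (v t) t
  dv : ∀ t, a ≤ t → HasDerivAt v (v t - (cT θ b t * v t + rT θ b t * w t)) t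
  lim : Tendsto w atTop (𝓝 1)
  bd : ∃ N : ℝ, ∀ t, a ≤ t → |v t| ≤ N / t ^ 2

lemma b1 (b s : ℝ) (hb : 0 ≤ b) (hs : 0 < s) : |2 * b / (s * (b + 2 * s))| ≤ b / s ^ 2 := by
  rw [abs_of_nonneg (by positivity), div_le_div_iff₀ (by positivity) (by positivity)]
  have : 0 ≤ b * s * b := by positivity
  nlinarith

lemma b2 (b s : ℝ) (hb : 0 ≤ b) (hs : 0 < s) : |4 * b / (s * (b + 2 * s) ^ 2)| ≤ b / s ^ 3 := by
  rw [abs_of_nonneg (by positivity), div_le_div_iff₀ (by positivity) (by positivity)]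
  have : b * (s * (b + 2 * s)^2) = 4 * b * s ^ 3 + (b * s * b^2 + b * s * 4 * b * s) := by ring
  have h : 0 ≤ (b * s * b^2 + b * s * 4 * b * s) := by positivity
  linarith

lemma b3 (Θ θ b s : ℝ) (hb : 0 ≤ b) (hs : 0 < s) (hθ : |θ| ≤ Θ) :
    |2 * b * θ / (s ^ 2 * (b + 2 * s))| ≤ Θ * (b / s ^ 3) := by
  have hΘ : 0 ≤ Θ := (abs_nonneg _).trans hθ
  have : 2 * b * θ / (s ^ 2 * (b + 2 * s)) = θ * (2 * b / (s * (b + 2 * s)) / s) := by field_simp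
  rw [this, abs_mul, abs_div, abs_of_pos hs]
  have h2 : |2 * b / (s * (b + 2 * s))| / s ≤ b / s^2 / s := by gcongr; exact b1 b s hb hs
  have h3 : b / s^2 / s = b / s^3 := by field_simp
  rw [h3] at h2
  exact mul_le_mul hθ h2 (by positivity) hΘ

lemma b4 (a b s : ℝ) (ha : 0 < a) (hb : 0 ≤ b) (hs : a ≤ s) : b / s ^ 2 ≤ (b / a) / s := by
  have := ha.trans_le hs
  rw [div_div, div_le_div_iff₀ (by positivity) (by positivity)]
  have : 0 ≤ b * s * (s - a) := by apply mul_nonneg; positivity; linarith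
  nlinarith

lemma b5 (a b s : ℝ) (ha : 0 < a) (hb : 0 ≤ b) (hs : a ≤ s) : b / s ^ 3 ≤ (b / a) / s ^ 2 := by
  have h := ha.trans_le hs
  have := b4 a b s ha hb hs
  have h2 : b / s ^ 3 = b / s ^ 2 / s := by field_simp
  have h3 : b / a / s ^ 2 = b / a / s / s := by field_simp
  rw [h2, h3]; gcongr

lemma cdiff (a Θ θ θ' b s : ℝ) (ha : 0 < a) (hΘ : 1 ≤ Θ) (hb : 0 ≤ b) (hs : a ≤ s) :
    |cT θ b s - cT θ' 0 s| ≤ ((2 * Θ + 1) * |θ - θ'| + (1 + Θ) * (b / a)) / s := by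
  have hsp := ha.trans_le hs
  have h1 := (b1 b s hb hsp).trans (b4 a b s ha hb hs)
  have : cT θ b s - cT θ' 0 s = (- 2 * (θ - θ')) / s - 2 * b / (s * (b + 2 * s)) := by
    unfold cT; field_simp; ring
  rw [this]
  have h2 := abs_sub ((- 2 * (θ - θ')) / s) (2 * b / (s * (b + 2 * s)))
  have h3 : |(- 2 * (θ - θ')) / s| = 2 * |θ - θ'| / s := by
    rw [abs_div, abs_mul, abs_of_pos hsp]; norm_num
  have h4 : 2 * |θ - θ'| / s + b / a / s ≤ ((2 * Θ + 1) * |θ - θ'| + (1 + Θ) * (b / a)) / s := by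
    rw [← add_div]
    have h5 : 0 ≤ b / a := by positivity
    have h6 : 0 ≤ |θ - θ'| := abs_nonneg _
    gcongr
    · linarith
    · nlinarith
  linarith

lemma rdiff (a Θ θ θ' b s : ℝ) (ha : 0 < a) (hΘ : 1 ≤ Θ) (hθ : |θ| ≤ Θ) (hθ' : |θ'| ≤ Θ) (hb : 0 ≤ b) (hs : a ≤ s) :
    |rT θ b s - rT θ' 0 s| ≤ ((2 * Θ + 1) * |θ - θ'| + (1 + Θ) * (b / a)) / s ^ 2 := by
  have hsp := ha.trans_le hs
  have h1 := (b2 b s hb hsp).trans (b5 a b s ha hb hs)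
  have h2 := (b3 Θ θ b s hb hsp hθ).trans (mul_le_mul_of_nonneg_left (b5 a b s ha hb hs) (by linarith))
  have : rT θ b s - rT θ' 0 s = ((θ - θ') * (θ + θ' - 1)) / s^2 + 4 * b / (s * (b + 2 * s) ^ 2) + 2 * b * θ / (s ^ 2 * (b + 2 * s)) := by
    unfold rT; field_simp; ring
  rw [this]
  have h3 := abs_add_three (((θ - θ') * (θ + θ' - 1)) / s^2) (4 * b / (s * (b + 2 * s) ^ 2)) (2 * b * θ / (s ^ 2 * (b + 2 * s)))
  have h4 : |((θ - θ') * (θ + θ' - 1)) / s^2| ≤ (2 * Θ + 1) * |θ - θ'| / s^2 := by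
    rw [abs_div, abs_mul, abs_of_pos (show 0 < s^2 by positivity), mul_comm]
    gcongr
    rw [abs_le] at *
    constructor <;> linarith
  have h5 : ((2 * Θ + 1) * |θ - θ'| + (1 + Θ) * (b / a)) / s ^ 2 = (2 * Θ + 1) * |θ - θ'| / s^2 + b / a / s^2 + Θ * (b / a / s^2) := by ring
  linarith

lemma cbound (a Θ θ b s : ℝ) (ha : 0 < a) (hΘ : 1 ≤ Θ) (hθ : |θ| ≤ Θ) (hb : 0 ≤ b) (hba : b ≤ a) (hs : a ≤ s) :
    |cT θ b s| ≤ (4 * (Θ + 2) ^ 2) / s := by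
  have hsp := ha.trans_le hs
  have h := cdiff a Θ θ 0 b s ha hΘ hb hs
  have h0 : |cT 0 0 s| = 2 / s := by unfold cT; simp; positivity
  have h1 : |cT θ b s| ≤ |cT θ b s - cT 0 0 s| + |cT 0 0 s| := by simpa using abs_add_le (cT θ b s - cT 0 0 s) (cT 0 0 s)
  have h2 : b / a ≤ 1 := by rw [div_le_one ha]; exact hba
  have h3 : ((2 * Θ + 1) * |θ - 0| + (1 + Θ) * (b / a)) / s + 2 / s ≤ (4 * (Θ + 2) ^ 2) / s := by
    rw [← add_div]; rw [sub_zero]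
    gcongr
    have : (2 * Θ + 1) * |θ| ≤ (2 * Θ + 1) * Θ := by gcongr
    have : (1 + Θ) * (b / a) ≤ (1 + Θ) * 1 := by gcongr
    nlinarith
  linarith

lemma rbound (a Θ θ b s : ℝ) (ha : 0 < a) (hΘ : 1 ≤ Θ) (hθ : |θ| ≤ Θ) (hb : 0 ≤ b) (hba : b ≤ a) (hs : a ≤ s) :
    |rT θ b s| ≤ (4 * (Θ + 2) ^ 2) / s ^ 2 := by
  have hsp := ha.trans_le hs
  have h := rdiff a Θ θ 0 b s ha hΘ hθ (by simp; linarith) hb hs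
  have h0 : rT 0 0 s = 0 := by unfold rT; simp
  rw [h0, sub_zero] at h
  refine h.trans ?_
  have h2 : b / a ≤ 1 := by rw [div_le_one ha]; exact hba
  gcongr
  rw [sub_zero]
  have : (2 * Θ + 1) * |θ| ≤ (2 * Θ + 1) * Θ := by gcongr
  have : (1 + Θ) * (b / a) ≤ (1 + Θ) * 1 := by gcongr
  nlinarith

lemma contOn_cT (a θ b : ℝ) (ha : 0 < a) (hb : 0 ≤ b) : ContinuousOn (cT θ b) (Ici a) := by
  unfold cT
  intro s hs
  have hsp : 0 < s := ha.trans_le hs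
  apply ContinuousAt.continuousWithinAt
  have h1 : s * (b + 2 * s) ≠ 0 := by positivity
  have := hsp.ne'
  fun_prop (disch := assumption)

lemma contOn_rT (a θ b : ℝ) (ha : 0 < a) (hb : 0 ≤ b) : ContinuousOn (rT θ b) (Ici a) := by
  unfold rT
  intro s hs
  have hsp : 0 < s := ha.trans_le hs
  apply ContinuousAt.continuousWithinAt
  have h1 : s * (b + 2 * s) ^ 2 ≠ 0 := by positivity
  have h2 : s ^ 2 * (b + 2 * s) ≠ 0 := by positivity
  have h3 : s ^ 2 ≠ 0 := by positivity
  fun_prop (disch := assumption)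

lemma sol_exists (a θ b : ℝ) (ha : 0 < a) (hb : 0 ≤ b) (hba : b ≤ a) : ∃ w v, IsSol a θ b w v := by
  have hΘ : 1 ≤ |θ| + 1 := by have := abs_nonneg θ; linarith
  obtain ⟨w, v, h1, h2, h3, h4⟩ := aux_exist a (4 * (|θ| + 1 + 2) ^ 2) ha (by nlinarith) (cT θ b) (rT θ b)
    (contOn_cT a θ b ha hb) (contOn_rT a θ b ha hb)
    (fun s hs => cbound a _ θ b s ha hΘ (by linarith) hb hba hs)
    (fun s hs => rbound a _ θ b s ha hΘ (by linarith) hb hba hs)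
  exact ⟨w, v, h1, h2, h3, h4⟩

lemma sol_bounds (a Θ : ℝ) (ha : 0 < a) (hΘ : 1 ≤ Θ) : ∃ K : ℝ, 0 < K ∧ ∀ θ b w v, |θ| ≤ Θ → 0 ≤ b → b ≤ a →
    IsSol a θ b w v → ∀ t, a ≤ t → |v t| ≤ K / t ^ 2 ∧ |w t - 1| ≤ K / t ∧ |w t| ≤ K := by
  set C := 4 * (Θ + 2) ^ 2 with hC
  have hC1 : 1 ≤ C := by nlinarith
  set K := 2 * C * exp (4 * C ^ 2 / a) with hK
  have hKp : 0 < K := by positivity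
  refine ⟨K + (1 + K / a), by positivity, ?_⟩
  intro θ b w v hθ hb hba hs
  have h1 : ∀ t, a ≤ t → |v t| ≤ K / t ^ 2 := by
    intro t ht
    have := (aux_est a C 0 1 ha hC1 le_rfl (cT θ b) (rT θ b) (fun _ => 0) w v
      (fun s hs => cbound a _ θ b s ha hΘ hθ hb hba hs)
      (fun s hs => rbound a _ θ b s ha hΘ hθ hb hba hs) (by simp) hs.dw hs.lim
      (by simpa using hs.dv) hs.bd t ht).1
    refine this.trans ?_
    have h2 := mW_le (4 * C^2) a t (by positivity) ha ht
    calc _ ≤ (2 * (C * |1| + 0)) * (exp (4 * C ^ 2 / a) / t ^ 2) := by gcongr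
      _ = _ := by rw [hK]; simp; ring
  have h2 : ∀ t, a ≤ t → |w t - 1| ≤ K / t := by
    apply aux_compare a (fun t => w t - 1) (fun t => - v t) _ (fun t => K / t^2)
    · intro t ht; simpa using (hs.dw t ht).sub_const 1
    · intro t ht
      have := ((hasDerivAt_inv (ha.trans_le ht).ne').const_mul K)
      exact this.congr_deriv (by field_simp)
    · intro t ht; simpa using h1 t ht
    · simpa using hs.lim.sub_const 1
    · exact tendsto_div_zero K
  intro t ht
  have htp := ha.trans_le ht
  have hKa : 0 < K / a := by positivity
  have e2 : K / t ≤ K / a := by gcongr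
  refine ⟨(h1 t ht).trans ?_, (h2 t ht).trans ?_, ?_⟩
  · gcongr; linarith
  · gcongr; linarith
  · have := abs_add_le (w t - 1) 1
    have h3 := h2 t ht
    simp at this
    linarith

lemma sol_diff (a Θ : ℝ) (ha : 0 < a) (hΘ : 1 ≤ Θ) : ∃ K : ℝ, 0 < K ∧ ∀ θ θ' b w v w' v', |θ| ≤ Θ → |θ'| ≤ Θ →
    0 ≤ b → b ≤ a → IsSol a θ b w v → IsSol a θ' 0 w' v' → ∀ t, a ≤ t →
    |v t - v' t| ≤ K * (|θ - θ'| + b) / t ^ 2 ∧ |w t - w' t| ≤ K * (|θ - θ'| + b) ∧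
    |(v t - (cT θ b t * v t + rT θ b t * w t)) - (v' t - (cT θ' 0 t * v' t + rT θ' 0 t * w' t))|
      ≤ K * (|θ - θ'| + b) / t ^ 2 := by
  obtain ⟨K0, hK0, hb0⟩ := sol_bounds a Θ ha hΘ
  set C := 4 * (Θ + 2) ^ 2 with hC
  have hC1 : 1 ≤ C := by nlinarith
  set A1 := (2 * Θ + 1) + (1 + Θ) / a with hA1
  have hA1p : 0 < A1 := by positivity
  set A2 := A1 * K0 * (1 / a + 1) with hA2
  have hA2p : 0 < A2 := by positivity
  set K1 := 2 * A2 * exp (4 * C ^ 2 / a) with hK1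
  have hK1p : 0 < K1 := by positivity
  set K2 := K1 / a with hK2
  have hK2p : 0 < K2 := by positivity
  refine ⟨(K1 + C / a * K1 + C * K2 + A2) + K2, by positivity, ?_⟩
  intro θ θ' b w v w' v' hθ hθ' hb hba hs hs'
  set d := |θ - θ'| + b with hd
  have hd0 : 0 ≤ d := by positivity
  have hdle : (2 * Θ + 1) * |θ - θ'| + (1 + Θ) * (b / a) ≤ A1 * d := by
    have e : A1 * d = (2 * Θ + 1) * |θ - θ'| + (1 + Θ) * (b / a) + ((2 * Θ + 1) * b + (1 + Θ) / a * |θ - θ'|) := by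
      rw [hA1, hd]; ring
    have : 0 ≤ (2 * Θ + 1) * b + (1 + Θ) / a * |θ - θ'| := by positivity
    linarith
  set g : ℝ → ℝ := fun t => (cT θ b t - cT θ' 0 t) * v' t + (rT θ b t - rT θ' 0 t) * w' t with hg
  have hgb : ∀ t, a ≤ t → |g t| ≤ (A2 * d) / t ^ 2 := by
    intro t ht
    have htp := ha.trans_le ht
    obtain ⟨p1, p2, p3⟩ := hb0 θ' 0 w' v' hθ' le_rfl ha.le hs' t ht
    have q1 : |cT θ b t - cT θ' 0 t| ≤ A1 * d / a := by
      refine (cdiff a Θ θ θ' b t ha hΘ hb ht).trans ?_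
      gcongr
    have q2 : |rT θ b t - rT θ' 0 t| ≤ A1 * d / t^2 := by
      refine (rdiff a Θ θ θ' b t ha hΘ hθ hθ' hb ht).trans ?_
      gcongr
    calc |g t| ≤ |(cT θ b t - cT θ' 0 t) * v' t| + |(rT θ b t - rT θ' 0 t) * w' t| := abs_add_le _ _
      _ ≤ A1 * d / a * (K0 / t^2) + A1 * d / t^2 * K0 := by
        rw [abs_mul, abs_mul]; gcongr
      _ = _ := by rw [hA2]; field_simp
  have heq : ∀ t, (v t - (cT θ b t * v t + rT θ b t * w t)) - (v' t - (cT θ' 0 t * v' t + rT θ' 0 t * w' t))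
      = (v t - v' t) - (cT θ b t * (v t - v' t) + rT θ b t * (w t - w' t) + g t) := by
    intro t; rw [hg]; ring
  have hest := aux_est a C (A2 * d) 0 ha hC1 (by positivity) (cT θ b) (rT θ b) g (fun t => w t - w' t) (fun t => v t - v' t)
      (fun s hs => cbound a _ θ b s ha hΘ hθ hb hba hs)
      (fun s hs => rbound a _ θ b s ha hΘ hθ hb hba hs) hgb
      (fun t ht => (hs.dw t ht).sub (hs'.dw t ht)) (by simpa using hs.lim.sub hs'.lim)
      (fun t ht => ((hs.dv t ht).sub (hs'.dv t ht)).congr_deriv (heq t))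
      (by
        obtain ⟨N, hN⟩ := hs.bd
        obtain ⟨N', hN'⟩ := hs'.bd
        refine ⟨N + N', fun t ht => (abs_sub _ _).trans ?_⟩
        rw [add_div]; exact add_le_add (hN t ht) (hN' t ht))
  have h1 : ∀ t, a ≤ t → |v t - v' t| ≤ K1 * d / t ^ 2 := by
    intro t ht
    refine ((hest t ht).1).trans ?_
    have h2 := mW_le (4 * C^2) a t (by positivity) ha ht
    calc _ ≤ (2 * (C * |0| + A2 * d)) * (exp (4 * C ^ 2 / a) / t ^ 2) := by gcongr
      _ = _ := by rw [hK1]; simp; ring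
  have h2 : ∀ t, a ≤ t → |w t - w' t| ≤ K1 * d / t := by
    apply aux_compare a (fun t => w t - w' t) (fun t => - (v t - v' t)) _ (fun t => K1 * d / t^2)
    · intro t ht; exact ((hs.dw t ht).sub (hs'.dw t ht)).congr_deriv (by simp)
    · intro t ht
      have := ((hasDerivAt_inv (ha.trans_le ht).ne').const_mul (K1 * d))
      exact this.congr_deriv (by field_simp)
    · intro t ht; rw [abs_neg]; exact h1 t ht
    · simpa using hs.lim.sub hs'.lim
    · exact tendsto_div_zero (K1 * d)
  intro t ht
  have htp := ha.trans_le ht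
  have h2' : |w t - w' t| ≤ K2 * d := by
    refine (h2 t ht).trans ?_
    calc K1 * d / t ≤ K1 * d / a := by gcongr
      _ = _ := by rw [hK2]; ring
  refine ⟨(h1 t ht).trans ?_, h2'.trans ?_, ?_⟩
  · gcongr
    have : 0 ≤ C / a * K1 + C * K2 + A2 + K2 := by positivity
    linarith
  · gcongr
    have : 0 ≤ K1 + C / a * K1 + C * K2 + A2 := by positivity
    linarith
  · rw [heq]
    have cb := cbound a Θ θ b t ha hΘ hθ hb hba ht
    have cb' : |cT θ b t| ≤ C / a := cb.trans (by gcongr)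
    have rb := rbound a Θ θ b t ha hΘ hθ hb hba ht
    calc _ ≤ |v t - v' t| + |cT θ b t * (v t - v' t) + rT θ b t * (w t - w' t) + g t| := abs_sub _ _
      _ ≤ |v t - v' t| + (|cT θ b t * (v t - v' t)| + |rT θ b t * (w t - w' t)| + |g t|) := by
        gcongr; exact abs_add_three _ _ _
      _ ≤ K1 * d / t^2 + (C / a * (K1 * d / t^2) + C / t^2 * (K2 * d) + A2 * d / t^2) := by
        rw [abs_mul, abs_mul]
        have := h1 t ht
        have := hgb t ht
        gcongr
      _ = (K1 + C / a * K1 + C * K2 + A2) * d / t^2 := by ring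
      _ ≤ _ := by
        apply div_le_div_of_nonneg_right _ (by positivity)
        apply mul_le_mul_of_nonneg_right _ hd0
        linarith


lemma zero_count (z0 : ℝ) (w0 v0 : ℝ → ℝ) (Z : Finset ℝ)
    (hZ : ∀ t, z0 ≤ t → (w0 t = 0 ↔ t ∈ Z)) (hZ0 : ∀ ξ ∈ Z, z0 < ξ)
    (hd : ∀ t, z0 ≤ t → HasDerivAt w0 (v0 t) t) (vc : ∀ t, z0 ≤ t → ContinuousAt v0 t)
    (hv : ∀ ξ ∈ Z, v0 ξ ≠ 0) (lim : Tendsto w0 atTop (𝓝 1)) :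
    ∃ η > 0, ∀ w v : ℝ → ℝ, (∀ t, z0 ≤ t → HasDerivAt w (v t) t) →
      (∀ t, z0 ≤ t → |w t - w0 t| ≤ η) → (∀ t, z0 ≤ t → |v t - v0 t| ≤ η) →
      {z : ℝ | z0 ≤ z ∧ w z = 0}.Finite ∧ {z : ℝ | z0 ≤ z ∧ w z = 0}.ncard = Z.card := by
  -- choose ρ
  have hρ : ∃ ρ > 0, ∀ ξ ∈ Z, z0 < ξ - ρ ∧ (∀ t, |t - ξ| ≤ ρ → v0 ξ ^ 2 / 2 < v0 t * v0 ξ) ∧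
      ∀ ξ' ∈ Z, ξ' ≠ ξ → 2 * ρ < |ξ' - ξ| := by
    have : ∀ᶠ ρ in 𝓝[>] (0:ℝ), ∀ ξ ∈ Z, z0 < ξ - ρ ∧ (∀ t, |t - ξ| ≤ ρ → v0 ξ ^ 2 / 2 < v0 t * v0 ξ) ∧
      ∀ ξ' ∈ Z, ξ' ≠ ξ → 2 * ρ < |ξ' - ξ| := by
      rw [Finset.eventually_all]
      intro ξ hξ
      have small : ∀ e > 0, ∀ᶠ ρ in 𝓝[>] (0:ℝ), ρ < e := fun e he =>
        mem_nhdsWithin_of_mem_nhds (Iio_mem_nhds he)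
      refine Eventually.and ?_ (Eventually.and ?_ ?_)
      · filter_upwards [small (ξ - z0) (sub_pos.2 (hZ0 ξ hξ))] with ρ h; linarith
      · have h1 : Tendsto (fun t => v0 t * v0 ξ) (𝓝 ξ) (𝓝 (v0 ξ * v0 ξ)) :=
          (vc ξ (hZ0 ξ hξ).le).tendsto.mul_const _
        have h2 : v0 ξ ^ 2 / 2 < v0 ξ * v0 ξ := by
          have := sq_pos_of_ne_zero (hv ξ hξ)
          nlinarith
        obtain ⟨e, he, h3⟩ := Metric.eventually_nhds_iff.1 (h1.eventually (lt_mem_nhds h2))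
        filter_upwards [small e he] with ρ hρ t ht
        exact h3 (by rw [Real.dist_eq]; linarith)
      · rw [Finset.eventually_all]
        intro ξ' _
        by_cases h : ξ' = ξ
        · exact Eventually.of_forall fun _ h' => absurd h h'
        · have : 0 < |ξ' - ξ| := abs_pos.2 (sub_ne_zero.2 h)
          filter_upwards [small (|ξ' - ξ| / 2) (by positivity)] with ρ h1 _
          linarith
    obtain ⟨ρ, h1, h2⟩ := (this.and self_mem_nhdsWithin).exists
    exact ⟨ρ, h2, h1⟩
  obtain ⟨ρ, hρ0, hρ⟩ := hρ
  -- lower bound away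
  have hη1 : ∃ η > 0, ∀ t, z0 ≤ t → (∀ ξ ∈ Z, ρ ≤ |t - ξ|) → η ≤ |w0 t| := by
    obtain ⟨R, hR⟩ := eventually_atTop.1 (lim.eventually (lt_mem_nhds (show (1/2:ℝ) < 1 by norm_num)))
    set T : Set ℝ := Icc z0 R ∩ {t | ∀ ξ ∈ Z, ρ ≤ |t - ξ|} with hT
    have Tc : IsCompact T := by
      apply isCompact_Icc.inter_right
      have : {t : ℝ | ∀ ξ ∈ Z, ρ ≤ |t - ξ|} = ⋂ ξ ∈ Z, {t | ρ ≤ |t - ξ|} := by ext; simp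
      rw [this]
      exact isClosed_biInter fun ξ _ => isClosed_le continuous_const (by fun_prop)
    have w0c : ContinuousOn (fun t => |w0 t|) T := fun t ht =>
      ((hd t ht.1.1).continuousAt.abs).continuousWithinAt
    rcases T.eq_empty_or_nonempty with he | hne
    · refine ⟨1/2, by norm_num, fun t ht h => ?_⟩
      by_cases htR : t ≤ R
      · have : t ∈ T := ⟨⟨ht, htR⟩, h⟩
        rw [he] at this; exact absurd this (notMem_empty _)
      · exact (hR t (not_le.1 htR).le).le.trans (le_abs_self _)
    · obtain ⟨x, hx, hmin⟩ := Tc.exists_isMinOn hne w0c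
      have hx0 : 0 < |w0 x| := by
        rw [abs_pos]; intro h0
        have := hx.2 x ((hZ x hx.1.1).1 h0)
        simp at this; linarith
      refine ⟨min (1/2) |w0 x|, by positivity, fun t ht h => ?_⟩
      by_cases htR : t ≤ R
      · exact (min_le_right _ _).trans (hmin ⟨⟨ht, htR⟩, h⟩)
      · exact (min_le_left _ _).trans ((hR t (not_le.1 htR).le).le.trans (le_abs_self _))
  obtain ⟨η1, hη10, hη1⟩ := hη1
  have hη2 : ∃ η > 0, ∀ ξ ∈ Z, η < |v0 ξ| / 2 := by
    have : ∀ᶠ η in 𝓝[>] (0:ℝ), ∀ ξ ∈ Z, η < |v0 ξ| / 2 := by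
      rw [Finset.eventually_all]
      intro ξ hξ
      have := abs_pos.2 (hv ξ hξ)
      exact mem_nhdsWithin_of_mem_nhds (Iio_mem_nhds (by positivity))
    obtain ⟨ρ, h1, h2⟩ := (this.and self_mem_nhdsWithin).exists
    exact ⟨ρ, h2, h1⟩
  obtain ⟨η2, hη20, hη2⟩ := hη2
  refine ⟨min (η1 / 2) η2, by positivity, ?_⟩
  intro w v hw hww hvv
  have far : ∀ t, z0 ≤ t → (∀ ξ ∈ Z, ρ ≤ |t - ξ|) → 0 < w t * w0 t := by
    intro t ht h
    have h1 := hη1 t ht h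
    have h2 := (hww t ht).trans (min_le_left _ _)
    have h3 : w t * w0 t = w0 t ^ 2 + (w t - w0 t) * w0 t := by ring
    have h4 : -(|w t - w0 t| * |w0 t|) ≤ (w t - w0 t) * w0 t := by rw [← abs_mul]; exact neg_abs_le _
    have h5 : |w t - w0 t| * |w0 t| ≤ (|w0 t| / 2) * |w0 t| := by gcongr; linarith
    have h6 := sq_abs (w0 t)
    have h7 : 0 < |w0 t| := by linarith
    nlinarith
  have near : ∀ ξ ∈ Z, ∀ t, |t - ξ| ≤ ρ → 0 < v t * v0 ξ := by
    intro ξ hξ t ht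
    have hz : z0 ≤ t := by have := (hρ ξ hξ).1; have := (abs_le.1 ht).1; linarith
    have h1 := (hρ ξ hξ).2.1 t ht
    have h2 := (hvv t hz).trans (min_le_right _ _)
    have h3 : v t * v0 ξ = v0 t * v0 ξ + (v t - v0 t) * v0 ξ := by ring
    have h4 : -(|v t - v0 t| * |v0 ξ|) ≤ (v t - v0 t) * v0 ξ := by rw [← abs_mul]; exact neg_abs_le _
    have h5 : |v t - v0 t| * |v0 ξ| ≤ (|v0 ξ| / 2) * |v0 ξ| := by
      gcongr; exact h2.trans (hη2 ξ hξ).le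
    have h6 := sq_abs (v0 ξ)
    nlinarith
  have mono : ∀ (u u' : ℝ → ℝ), (∀ t, z0 ≤ t → HasDerivAt u (u' t) t) → ∀ ξ ∈ Z,
      (∀ t, |t - ξ| ≤ ρ → 0 < u' t * v0 ξ) → StrictMonoOn (fun t => u t * v0 ξ) (Icc (ξ - ρ) (ξ + ρ)) := by
    intro u u' hu ξ hξ h
    have hz := (hρ ξ hξ).1
    apply strictMonoOn_of_deriv_pos (convex_Icc _ _)
    · intro t ht; exact ((hu t (by linarith [ht.1])).continuousAt.mul continuousAt_const).continuousWithinAt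
    · intro t ht
      rw [interior_Icc] at ht
      rw [((hu t (by linarith [ht.1])).mul_const (v0 ξ)).deriv]
      exact h t (by rw [abs_le]; constructor <;> linarith [ht.1, ht.2])
  have ex : ∀ ξ : ℝ, ∃ x, ξ ∈ Z → (|x - ξ| < ρ ∧ w x = 0) := by
    intro ξ
    by_cases hξ : ξ ∈ Z
    swap
    · exact ⟨0, fun h => absurd h hξ⟩
    have hz := (hρ ξ hξ).1
    have m0 := mono w0 v0 hd ξ hξ (fun t ht => (by positivity : (0:ℝ) ≤ v0 ξ ^ 2 / 2).trans_lt ((hρ ξ hξ).2.1 t ht))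
    have w0ξ : w0 ξ = 0 := (hZ ξ (by linarith)).2 hξ
    have a1 : w0 (ξ - ρ) * v0 ξ < 0 := by
      have := m0 (left_mem_Icc.2 (by linarith)) (show ξ ∈ Icc (ξ - ρ) (ξ + ρ) by constructor <;> linarith) (by linarith : ξ - ρ < ξ)
      simpa [w0ξ] using this
    have a2 : 0 < w0 (ξ + ρ) * v0 ξ := by
      have := m0 (show ξ ∈ Icc (ξ - ρ) (ξ + ρ) by constructor <;> linarith) (right_mem_Icc.2 (by linarith)) (by linarith : ξ < ξ + ρ)
      simpa [w0ξ] using this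
    have sep : ∀ x, |x - ξ| = ρ → ∀ ξ' ∈ Z, ρ ≤ |x - ξ'| := by
      intro x hx ξ' hξ'
      by_cases h : ξ' = ξ
      · rw [h, hx]
      · have := (hρ ξ hξ).2.2 ξ' hξ' h
        have h2 := abs_sub_le ξ' x ξ
        rw [abs_sub_comm ξ' x] at h2
        linarith
    have f1 := far (ξ - ρ) (by linarith) (sep _ (by simp [abs_of_pos hρ0]))
    have f2 := far (ξ + ρ) (by linarith) (sep _ (by simp [abs_of_pos hρ0]))
    have g1 : w (ξ - ρ) * v0 ξ < 0 := by
      by_contra h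
      have : (w (ξ - ρ) * v0 ξ) * (w0 (ξ - ρ) * v0 ξ) ≤ 0 := mul_nonpos_of_nonneg_of_nonpos (not_lt.1 h) a1.le
      have h2 : (w (ξ - ρ) * v0 ξ) * (w0 (ξ - ρ) * v0 ξ) = (w (ξ - ρ) * w0 (ξ - ρ)) * v0 ξ ^ 2 := by ring
      have h3 := mul_pos f1 (sq_pos_of_ne_zero (hv ξ hξ))
      linarith
    have g2 : 0 < w (ξ + ρ) * v0 ξ := by
      by_contra h
      have : (w (ξ + ρ) * v0 ξ) * (w0 (ξ + ρ) * v0 ξ) ≤ 0 := mul_nonpos_of_nonpos_of_nonneg (not_lt.1 h) a2.le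
      have h2 : (w (ξ + ρ) * v0 ξ) * (w0 (ξ + ρ) * v0 ξ) = (w (ξ + ρ) * w0 (ξ + ρ)) * v0 ξ ^ 2 := by ring
      have h3 := mul_pos f2 (sq_pos_of_ne_zero (hv ξ hξ))
      linarith
    have cont : ContinuousOn (fun t => w t * v0 ξ) (Icc (ξ - ρ) (ξ + ρ)) := by
      intro t ht; exact ((hw t (by linarith [ht.1])).continuousAt.mul continuousAt_const).continuousWithinAt
    obtain ⟨x, hx, hx0⟩ := intermediate_value_Ioo (by linarith) cont ⟨g1, g2⟩
    refine ⟨x, fun _ => ⟨?_, ?_⟩⟩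
    · rw [abs_lt]; constructor <;> linarith [hx.1, hx.2]
    · exact (mul_eq_zero.1 hx0).resolve_right (hv ξ hξ)
  choose f hf using ex
  have himg : {z : ℝ | z0 ≤ z ∧ w z = 0} = f '' (Z : Set ℝ) := by
    ext x
    constructor
    · rintro ⟨hx, hx0⟩
      have : ∃ ξ ∈ Z, |x - ξ| < ρ := by
        by_contra h
        push Not at h
        have := far x hx h
        rw [hx0] at this; simp at this
      obtain ⟨ξ, hξ, hlt⟩ := this
      refine ⟨ξ, hξ, ?_⟩
      obtain ⟨h1, h2⟩ := hf ξ hξ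
      have m := mono w v hw ξ hξ (near ξ hξ)
      apply m.injOn
      · rw [abs_lt] at h1; constructor <;> linarith [h1.1, h1.2]
      · rw [abs_lt] at hlt; constructor <;> linarith [hlt.1, hlt.2]
      · simp [h2, hx0]
    · rintro ⟨ξ, hξ, rfl⟩
      obtain ⟨h1, h2⟩ := hf ξ hξ
      refine ⟨?_, h2⟩
      have := (hρ ξ hξ).1
      rw [abs_lt] at h1; linarith
  have hinj : InjOn f (Z : Set ℝ) := by
    intro ξ hξ ξ' hξ' h
    by_contra hne
    have h1 := (hf ξ hξ).1
    have h2 := (hf ξ' hξ').1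
    have h3 := (hρ ξ hξ).2.2 ξ' hξ' (fun h => hne h.symm)
    rw [h] at h1
    have := abs_sub_le ξ' (f ξ') ξ
    rw [abs_sub_comm ξ' (f ξ')] at this
    linarith
  rw [himg]
  refine ⟨Z.finite_toSet.image f, ?_⟩
  rw [ncard_image_of_injOn hinj, ncard_coe_finset]

/-! Laguerre-type polynomials -/
open Polynomial in
noncomputable def lagP : ℕ → ℝ[X]
  | 0 => 1
  | (m+1) => (X - C ((m:ℝ) + 2)) * lagP m - X * derivative (lagP m)

open Polynomial in
lemma lagP_monic (m : ℕ) : (lagP m).Monic ∧ (lagP m).natDegree = m := by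
  induction m with
  | zero => simp [lagP]
  | succ m ih =>
    have h1 : ((X - C ((m:ℝ) + 2)) * lagP m).Monic := (monic_X_sub_C _).mul ih.1
    have hdeg : ((X - C ((m:ℝ) + 2)) * lagP m).natDegree = m + 1 := by
      rw [(monic_X_sub_C _).natDegree_mul ih.1, natDegree_X_sub_C, ih.2]; ring
    have h2 : (X * derivative (lagP m)).degree < ((X - C ((m:ℝ) + 2)) * lagP m).degree := by
      rw [degree_eq_natDegree h1.ne_zero, hdeg]
      rcases Nat.eq_zero_or_pos m with rfl | hm
      · simp [lagP]
      · refine degree_lt_iff_coeff_zero _ _ |>.2 ?_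
        intro k hk
        obtain ⟨k, rfl⟩ : ∃ j, k = j + 1 := ⟨k - 1, by simp at hk; omega⟩
        rw [coeff_X_mul]
        rw [coeff_derivative, coeff_eq_zero_of_natDegree_lt (by simp at hk; omega)]; simp
    refine ⟨h1.sub_of_left h2, ?_⟩
    rw [lagP, natDegree_eq_of_degree_eq (degree_sub_eq_left_of_degree_lt h2), hdeg]

lemma lagP_ode (m : ℕ) (z : ℝ) : z * (lagP m).derivative.derivative.eval z + (2 - z) * (lagP m).derivative.eval z
    + m * (lagP m).eval z = 0 := by
  have key : ∀ m : ℕ, Polynomial.X * (lagP m).derivative.derivative + (2 - Polynomial.X) * (lagP m).derivative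
    + (m : Polynomial ℝ) * (lagP m) = 0 := by
    intro m
    induction m with
    | zero => simp [lagP]
    | succ m ih =>
      have h2 : Polynomial.C ((m:ℝ) + 2) = (m : Polynomial ℝ) + 2 := by simp; rfl
      have d1 : (lagP (m+1)).derivative = ((m:Polynomial ℝ)+1) * (lagP m - (lagP m).derivative) := by
        rw [lagP, h2]; simp
        linear_combination (-1) * ih
      have d2 : (lagP (m+1)).derivative.derivative = ((m:Polynomial ℝ)+1) * ((lagP m).derivative - (lagP m).derivative.derivative) := by
        rw [d1]; simp
      rw [d2, d1, lagP, h2]; push_cast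
      linear_combination (-(m+1)) * ih
  have := congrArg (Polynomial.eval z) (key m)
  simpa using this

lemma lagP_hasDeriv (m : ℕ) (z : ℝ) : HasDerivAt (fun z => exp (-z) * z ^ (m + 2) * (lagP m).eval z)
    (-(exp (-z) * z ^ (m + 1) * (lagP (m+1)).eval z)) z := by
  have h3 : HasDerivAt (fun s : ℝ => exp (-s)) (-exp (-z)) z := by
    simpa using (hasDerivAt_neg z).exp
  have h := (h3.mul (hasDerivAt_pow (m+2) z)).mul ((lagP m).hasDerivAt z)
  refine h.congr_deriv ?_
  simp only [lagP]
  simp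
  ring

lemma lagP_roots (m : ℕ) : ∃ x : ℕ → ℝ, x 0 = 0 ∧ ∀ i < m, x i < x (i + 1) ∧ (lagP m).eval (x (i + 1)) = 0 := by
  induction m with
  | zero => exact ⟨fun _ => 0, rfl, by simp⟩
  | succ m ih =>
    obtain ⟨x, x0, hx⟩ := ih
    have hnn : ∀ i ≤ m, 0 ≤ x i := by
      intro i
      induction i with
      | zero => intro _; rw [x0]
      | succ i ih => intro h; exact (ih (by omega)).trans (hx i (by omega)).1.le
    have hφ : ∀ i ≤ m, exp (-(x i)) * (x i) ^ (m + 2) * (lagP m).eval (x i) = 0 := by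
      intro i hi
      rcases i with _ | i
      · rw [x0]; simp
      · rw [(hx i (by omega)).2]; simp
    have fin : ∀ y, 0 < y → -(exp (-y) * y ^ (m + 1) * (lagP (m+1)).eval y) = 0 → (lagP (m+1)).eval y = 0 := by
      intro y hy h
      have : exp (-y) * y ^ (m + 1) ≠ 0 := by positivity
      rw [neg_eq_zero] at h
      exact (mul_eq_zero.1 h).resolve_left this
    have ex : ∀ i, ∃ y, i ≤ m → (x i < y ∧ (i < m → y < x (i + 1)) ∧ (lagP (m+1)).eval y = 0) := by
      intro i
      by_cases hi : i ≤ m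
      swap
      · exact ⟨0, fun h => absurd h hi⟩
      by_cases him : i < m
      · obtain ⟨y, hy, hy0⟩ := exists_hasDerivAt_eq_zero (hx i him).1
          (fun t _ => (lagP_hasDeriv m t).continuousAt.continuousWithinAt)
          ((hφ i hi).trans (hφ (i+1) (by omega)).symm) (fun t _ => lagP_hasDeriv m t)
        refine ⟨y, fun _ => ⟨hy.1, fun _ => hy.2, fin y ((hnn i hi).trans_lt hy.1) hy0⟩⟩
      · have him : i = m := by omega
        subst him
        by_contra hcon
        push Not at hcon
        have hne : ∀ y, x i < y → (lagP (i+1)).eval y ≠ 0 := fun y hy => by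
          have := hcon y
          exact this.2 hy (fun h => by omega)
        have top1 : Tendsto (fun y => (lagP (i+1)).eval y) atTop atTop := by
          apply Polynomial.tendsto_atTop_of_leadingCoeff_nonneg
          · rw [Polynomial.degree_eq_natDegree (lagP_monic _).1.ne_zero, (lagP_monic _).2]; norm_cast; omega
          · rw [(lagP_monic _).1.leadingCoeff]; norm_num
        have pos : ∀ y, x i < y → 0 < (lagP (i+1)).eval y := by
          intro y hy
          by_contra hneg
          obtain ⟨Y, hY, hY'⟩ := ((top1.eventually_gt_atTop 0).and (eventually_gt_atTop y)).exists
          obtain ⟨u, hu, hu0⟩ := intermediate_value_Icc hY'.le ((lagP (i+1)).continuous.continuousOn)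
            (show (0:ℝ) ∈ Icc _ _ from ⟨not_lt.1 hneg, hY.le⟩)
          exact hne u (hy.trans_le hu.1) hu0
        have anti : StrictAntiOn (fun z => exp (-z) * z ^ (i + 2) * (lagP i).eval z) (Ici (x i)) := by
          apply strictAntiOn_of_deriv_neg (convex_Ici _)
          · exact fun t _ => (lagP_hasDeriv i t).continuousAt.continuousWithinAt
          · intro t ht
            rw [interior_Ici] at ht
            rw [(lagP_hasDeriv i t).deriv]
            have := pos t ht
            have : 0 < t := (hnn i hi).trans_lt ht
            rw [neg_lt_zero]; positivity
        have ev : ∀ᶠ y in atTop, 0 < (lagP i).eval y := by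
          rcases Nat.eq_zero_or_pos i with h0 | h0
          · subst h0; simp [lagP]
          · apply Tendsto.eventually_gt_atTop
            apply Polynomial.tendsto_atTop_of_leadingCoeff_nonneg
            · rw [Polynomial.degree_eq_natDegree (lagP_monic _).1.ne_zero, (lagP_monic _).2]; norm_cast
            · rw [(lagP_monic _).1.leadingCoeff]; norm_num
        obtain ⟨Y, hY, hY'⟩ := (ev.and (eventually_gt_atTop (x i))).exists
        have h1 := anti self_mem_Ici (show Y ∈ Ici (x i) from hY'.le) hY'
        simp only [hφ i hi] at h1
        have : 0 < Y := (hnn i hi).trans_lt hY'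
        have h2 : 0 < exp (-Y) * Y ^ (i + 2) * (lagP i).eval Y := by positivity
        linarith
    choose y hy using ex
    refine ⟨fun i => if i = 0 then 0 else y (i - 1), by simp, ?_⟩
    intro i hi
    simp only [Nat.add_eq_zero_iff, one_ne_zero, and_false, if_false, Nat.add_sub_cancel]
    refine ⟨?_, (hy i (by omega)).2.2⟩
    rcases i with _ | i
    · simp; have := (hy 0 (by omega)).1; rwa [x0] at this
    · simp
      exact ((hy i (by omega)).2.1 (by omega)).trans (hy (i+1) (by omega)).1

lemma lagP_zeros (m : ℕ) : ∃ Z : Finset ℝ, Z.card = m ∧ (∀ ξ ∈ Z, 0 < ξ) ∧ (∀ t, (lagP m).eval t = 0 ↔ t ∈ Z) ∧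
    ∀ ξ ∈ Z, (lagP m).derivative.eval ξ ≠ 0 := by
  obtain ⟨x, x0, hx⟩ := lagP_roots m
  have mono : ∀ j ≤ m, ∀ i < j, x i < x j := by
    intro j
    induction j with
    | zero => intro _ i hi; omega
    | succ j ih =>
      intro hj i hi
      have := (hx j (by omega)).1
      rcases Nat.lt_succ_iff_lt_or_eq.1 hi with h | h
      · exact (ih (by omega) i h).trans this
      · rw [h]; exact this
  set Z : Finset ℝ := (Finset.range m).image (fun i => x (i + 1)) with hZ
  have hcard : Z.card = m := by
    rw [hZ, Finset.card_image_of_injOn, Finset.card_range]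
    intro i hi j hj h
    simp at hi hj h
    rcases lt_trichotomy i j with hl | hl | hl
    · have := mono (j+1) (by omega) (i+1) (by omega); linarith
    · exact hl
    · have := mono (i+1) (by omega) (j+1) (by omega); linarith
  have hne := (lagP_monic m).1.ne_zero
  have hsub : Z.val ≤ (lagP m).roots := by
    rw [Multiset.le_iff_subset Z.nodup]
    intro ξ hξ
    rw [Finset.mem_val, hZ, Finset.mem_image] at hξ
    obtain ⟨i, hi, rfl⟩ := hξ
    rw [Polynomial.mem_roots hne]
    exact (hx i (by simpa using hi)).2
  have heq : Z.val = (lagP m).roots := by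
    apply Multiset.eq_of_le_of_card_le hsub
    have := (lagP m).card_roots'
    rw [(lagP_monic m).2] at this
    exact this.trans hcard.ge
  refine ⟨Z, hcard, ?_, ?_, ?_⟩
  · intro ξ hξ
    rw [hZ, Finset.mem_image] at hξ
    obtain ⟨i, hi, rfl⟩ := hξ
    have := mono (i+1) (by simp at hi; omega) 0 (by omega)
    rwa [x0] at this
  · intro t
    rw [← Finset.mem_val, heq, Polynomial.mem_roots hne]; rfl
  · intro ξ hξ h0
    have hroot : (lagP m).IsRoot ξ := by
      rw [← Polynomial.mem_roots hne, ← heq]; exact hξ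
    have h1 := (Polynomial.one_lt_rootMultiplicity_iff_isRoot hne).2 ⟨hroot, h0⟩
    rw [← Polynomial.count_roots, ← heq] at h1
    have := Multiset.nodup_iff_count_le_one.1 Z.nodup ξ
    omega


lemma poly_bd (R : Polynomial ℝ) (m : ℕ) (hR : R.natDegree < m + 1) (a : ℝ) (ha : 0 < a) :
    ∃ N, ∀ t, a ≤ t → |R.eval t| ≤ N * t ^ m := by
  refine ⟨∑ i ∈ Finset.range (m+1), |R.coeff i| / a ^ (m - i), fun t ht => ?_⟩
  rw [Polynomial.eval_eq_sum_range' hR, Finset.sum_mul]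
  refine (Finset.abs_sum_le_sum_abs _ _).trans (Finset.sum_le_sum fun i hi => ?_)
  have ht0 : 0 < t := ha.trans_le ht
  rw [abs_mul, abs_of_pos (pow_pos ht0 i)]
  have him : m = i + (m - i) := by simp at hi; omega
  have h1 : a ^ (m - i) ≤ t ^ (m - i) := pow_le_pow_left₀ ha.le ht _
  rw [div_mul_eq_mul_div, le_div_iff₀ (by positivity)]
  calc |R.coeff i| * t ^ i * a ^ (m - i) ≤ |R.coeff i| * t ^ i * t ^ (m - i) := by gcongr
    _ = |R.coeff i| * t ^ m := by rw [mul_assoc, ← pow_add, ← him]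

lemma lim_sol (n : ℕ) : ∃ (w0 v0 : ℝ → ℝ) (Z : Finset ℝ), Z.card = n - 1 ∧ (∀ ξ ∈ Z, 0 < ξ) ∧
    (∀ a, 0 < a → IsSol a (1 - (n:ℝ)) 0 w0 v0) ∧ (∀ t, 0 < t → (w0 t = 0 ↔ t ∈ Z)) ∧ (∀ ξ ∈ Z, v0 ξ ≠ 0) := by
  rcases n with _ | m
  · refine ⟨fun _ => 1, fun _ => 0, ∅, by simp, by simp, fun a ha => ⟨?_, ?_, ?_, ?_⟩, by simp, by simp⟩
    · intro t ht; exact hasDerivAt_const _ _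
    · intro t ht; refine (hasDerivAt_const _ _).congr_deriv ?_
      simp [cT, rT]
    · exact tendsto_const_nhds
    · exact ⟨0, by simp⟩
  obtain ⟨Z, hc, hpos, hZ, hder⟩ := lagP_zeros m
  set P := lagP m with hP
  have hode := lagP_ode m
  rw [← hP] at hode
  obtain ⟨hmon, hdeg⟩ := lagP_monic m
  rw [← hP] at hmon hdeg
  have hD : ∀ (Q : Polynomial ℝ) (k : ℕ) (t : ℝ), 0 < t → HasDerivAt (fun t => Q.eval t / t ^ k)
      (Q.derivative.eval t / t ^ k - k * Q.eval t / t ^ (k+1)) t := by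
    intro Q k t ht
    refine ((Q.hasDerivAt t).div (hasDerivAt_pow k t) (by positivity)).congr_deriv ?_
    rcases k with _ | k
    · simp
    · simp only [Nat.add_sub_cancel]; field_simp; push_cast; ring
  refine ⟨fun t => P.eval t / t ^ m, fun t => P.derivative.eval t / t ^ m - m * P.eval t / t ^ (m+1), Z, by simpa using hc, hpos, fun a ha => ⟨?_, ?_, ?_, ?_⟩, ?_, ?_⟩
  · intro t ht; exact hD P m t (ha.trans_le ht)
  · intro t ht
    have ht0 : 0 < t := ha.trans_le ht
    have h1 := (hD P.derivative m t ht0).sub ((hD P (m+1) t ht0).const_mul (m:ℝ))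
    have h2 := h1.congr_of_eventuallyEq (f₁ := fun t => P.derivative.eval t / t ^ m - m * P.eval t / t ^ (m+1))
      (Eventually.of_forall fun s => by simp [mul_div_assoc])
    refine h2.congr_deriv ?_
    have := hode t
    simp only [cT, rT]
    push_cast
    field_simp
    linear_combination (4 * t ^ 6 * t ^ (m * 2)) * this
  · have := Polynomial.div_tendsto_atTop_leadingCoeff_div_of_degree_eq P (Polynomial.X ^ m) (by
      rw [Polynomial.degree_eq_natDegree hmon.ne_zero, hdeg, Polynomial.degree_X_pow])
    simpa [hmon.leadingCoeff] using this
  · have hR : (Polynomial.X * (Polynomial.X * P.derivative - Polynomial.C (m:ℝ) * P)).natDegree < m + 1 := by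
      rcases Nat.eq_zero_or_pos m with h0 | h0
      · subst h0; simp [hP, lagP]
      rw [Nat.lt_succ_iff, Polynomial.natDegree_le_iff_coeff_eq_zero]
      intro k hk
      obtain ⟨k, rfl⟩ : ∃ j, k = j + 2 := ⟨k - 2, by omega⟩
      rw [Polynomial.coeff_X_mul, Polynomial.coeff_sub, Polynomial.coeff_X_mul, Polynomial.coeff_derivative, Polynomial.coeff_C_mul]
      rcases Nat.lt_or_ge m (k+1) with h | h
      · rw [Polynomial.coeff_eq_zero_of_natDegree_lt (by omega)]; simp
      · have : m = k + 1 := by omega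
        rw [this]; push_cast; ring
    obtain ⟨N, hN⟩ := poly_bd _ m hR a ha
    refine ⟨N, fun t ht => ?_⟩
    have ht0 : 0 < t := ha.trans_le ht
    have := hN t ht
    simp at this
    have e : P.derivative.eval t / t ^ m - m * P.eval t / t ^ (m+1) = (t * (t * P.derivative.eval t - m * P.eval t)) / (t ^ m * t^2) := by
      field_simp; ring
    rw [e, abs_div, abs_of_pos (show 0 < t ^ m * t ^ 2 by positivity), div_le_div_iff₀ (by positivity) (by positivity)]
    rw [abs_mul]
    calc _ ≤ N * t ^ m * t ^ 2 := by gcongr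
      _ = _ := by ring
  · intro t ht
    rw [← hZ]; simp [div_eq_zero_iff, ht.ne']
  · intro ξ hξ
    have := hpos ξ hξ
    have h0 := (hZ ξ).2 hξ
    simp [h0, hder ξ hξ, this.ne']


noncomputable def ps (a : ℕ → ℝ) (z : ℝ) : ℝ := ∑' i : ℕ, a i * z ^ i

def PB (A ρ : ℝ) (a : ℕ → ℝ) : Prop := ∀ i : ℕ, |a i| ≤ A * (ρ ^ i / (i.factorial : ℝ))

lemma PB.term {A ρ : ℝ} {a : ℕ → ℝ} (h : PB A ρ a) (z : ℝ) (i : ℕ) :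
    |a i * z ^ i| ≤ A * ((ρ * |z|) ^ i / (i.factorial : ℝ)) := by
  rw [abs_mul, abs_pow, mul_pow]
  calc _ ≤ A * (ρ ^ i / (i.factorial : ℝ)) * |z| ^ i := by gcongr; exact h i
    _ = _ := by ring

lemma PB.hasSum_exp (A x : ℝ) : HasSum (fun i : ℕ => A * (x ^ i / (i.factorial : ℝ))) (A * exp x) := by
  rw [Real.exp_eq_exp_ℝ]
  exact (NormedSpace.expSeries_div_hasSum_exp x).mul_left A

lemma PB.summable {A ρ : ℝ} {a : ℕ → ℝ} (h : PB A ρ a) (z : ℝ) : Summable (fun i => a i * z ^ i) :=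
  Summable.of_norm_bounded (PB.hasSum_exp A (ρ * |z|)).summable (fun i => by
    rw [Real.norm_eq_abs]; exact h.term z i)

lemma PB.bound {A ρ : ℝ} {a : ℕ → ℝ} (h : PB A ρ a) (z : ℝ) : |ps a z| ≤ A * exp (ρ * |z|) := by
  have := tsum_of_norm_bounded (PB.hasSum_exp A (ρ * |z|)) (f := fun i => a i * z ^ i) (fun i => by
    rw [Real.norm_eq_abs]; exact h.term z i)
  rwa [Real.norm_eq_abs] at this

def psd (a : ℕ → ℝ) (i : ℕ) : ℝ := (i + 1) * a (i + 1)

lemma PB.psd {A ρ : ℝ} {a : ℕ → ℝ} (h : PB A ρ a) : PB (A * ρ) ρ (psd a) := by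
  intro i
  have h1 := h (i + 1)
  unfold _root_.psd
  rw [abs_mul, abs_of_pos (by positivity : (0:ℝ) < i + 1)]
  calc _ ≤ ((i:ℝ) + 1) * (A * (ρ ^ (i + 1) / ((i+1).factorial : ℝ))) := by gcongr
    _ = _ := by rw [Nat.factorial_succ]; push_cast; field_simp; try ring

lemma PB.hasDeriv {A ρ : ℝ} {a : ℕ → ℝ} (h : PB A ρ a) (z : ℝ) :
    HasDerivAt (ps a) (ps (_root_.psd a) z) z := by
  set R := |z| + 1 with hR
  have key := hasDerivAt_tsum_of_isPreconnected (𝕜 := ℝ) (F := ℝ) (α := ℕ) (g := fun i z => a i * z ^ i)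
    (g' := fun i z => a i * (i * z ^ (i - 1))) (u := fun i => |a i| * (i * R ^ (i - 1)))
    (t := Metric.ball 0 R) (y₀ := 0) (y := z) ?_ Metric.isOpen_ball (convex_ball _ _).isPreconnected
    ?_ ?_ ?_ (h.summable 0) ?_
  · refine key.congr_deriv ?_
    have hs : Summable (fun i : ℕ => a i * (i * z ^ (i - 1))) := by
      rw [← summable_nat_add_iff 1]
      refine (h.psd.summable z).congr fun i => ?_
      simp [_root_.psd]; ring
    rw [hs.tsum_eq_zero_add]
    simp [ps, _root_.psd]
    refine tsum_congr fun i => ?_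
    ring
  · rw [← summable_nat_add_iff 1]
    refine (h.psd.summable R).abs.congr fun i => ?_
    have : 0 < R := by positivity
    simp [_root_.psd, abs_mul, abs_of_pos this, abs_of_pos (by positivity : (0:ℝ) < i + 1)]; ring
  · intro i y hy
    exact (hasDerivAt_pow i y).const_mul (a i)
  · intro i y hy
    simp at hy
    rw [Real.norm_eq_abs, abs_mul, abs_mul, abs_pow, Nat.abs_cast]
    gcongr
  · simp; positivity
  · simp [hR]

lemma PB.hasSum {A ρ : ℝ} {a : ℕ → ℝ} (h : PB A ρ a) (z : ℝ) : HasSum (fun i => a i * z ^ i) (ps a z) :=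
  (h.summable z).hasSum

lemma PB.hasSum_mul {A ρ : ℝ} {a : ℕ → ℝ} (h : PB A ρ a) (z : ℝ) :
    HasSum (fun i : ℕ => (match i with | 0 => 0 | (j+1) => a j) * z ^ i) (z * ps a z) := by
  rw [← hasSum_nat_add_iff' 1]
  simp
  refine ((h.hasSum z).mul_left z).congr_fun fun i => ?_
  ring

lemma PB.hasSum_zd {A ρ : ℝ} {a : ℕ → ℝ} (h : PB A ρ a) (z : ℝ) :
    HasSum (fun i : ℕ => (i * a i) * z ^ i) (z * ps (_root_.psd a) z) := by
  refine (h.psd.hasSum_mul z).congr_fun fun i => ?_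
  rcases i with _ | i
  · simp
  · simp [_root_.psd]


lemma digamma_succ (x : ℝ) (hx : ∀ m : ℕ, x ≠ -m) : digamma (x + 1) = digamma x + 1 / x := by
  have h0 : x ≠ 0 := by simpa using hx 0
  have hG : Real.Gamma x ≠ 0 := Real.Gamma_ne_zero hx
  have hd := (Real.differentiableAt_Gamma hx).hasDerivAt
  have h1 : HasDerivAt (fun y => Real.Gamma (y + 1)) (1 * Real.Gamma x + x * deriv Real.Gamma x) x := by
    refine ((hasDerivAt_id x).mul hd).congr_of_eventuallyEq ?_
    filter_upwards [isOpen_ne.mem_nhds h0] with y hy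
    exact Real.Gamma_add_one hy
  have h2 : deriv Real.Gamma (x + 1) = Real.Gamma x + x * deriv Real.Gamma x := by
    rw [← deriv_comp_add_const, h1.deriv]; ring
  unfold digamma
  rw [h2, Real.Gamma_add_one h0]
  field_simp
  try ring

lemma digamma_bd (x : ℝ) (hx : 0 < x) : log x - 1 / x ≤ digamma x ∧ digamma x ≤ log x := by
  have hne : ∀ y : ℝ, 0 < y → ∀ m : ℕ, y ≠ -m := fun y hy m h => by
    have : (0:ℝ) ≤ m := Nat.cast_nonneg m
    linarith
  have hd : ∀ y, 0 < y → HasDerivAt (Real.log ∘ Real.Gamma) (digamma y) y := fun y hy =>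
    (Real.differentiableAt_Gamma (hne y hy)).hasDerivAt.log (Real.Gamma_ne_zero (hne y hy))
  have hc := Real.convexOn_log_Gamma
  have hs : slope (Real.log ∘ Real.Gamma) x (x + 1) = log x := by
    rw [slope_def_field]
    simp only [Function.comp]
    rw [Real.Gamma_add_one hx.ne', Real.log_mul hx.ne' (Real.Gamma_ne_zero (hne x hx))]
    simp
  have h1 := hc.le_slope_of_hasDerivAt (mem_Ioi.2 hx) (mem_Ioi.2 (by linarith : 0 < x + 1)) (by linarith) (hd x hx)
  have h2 := hc.slope_le_of_hasDerivAt (mem_Ioi.2 hx) (mem_Ioi.2 (by linarith : 0 < x + 1)) (by linarith) (hd (x+1) (by linarith))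
  rw [hs] at h1 h2
  rw [digamma_succ x (hne x hx)] at h2
  exact ⟨by linarith, h1⟩

lemma digamma_abs (x : ℝ) (hx : 1 ≤ x) : |digamma x| ≤ x := by
  obtain ⟨h1, h2⟩ := digamma_bd x (by linarith)
  have h3 := Real.log_le_sub_one_of_pos (by linarith : 0 < x)
  have h4 := Real.log_nonneg hx
  have h5 : 1 / x ≤ 1 := by rw [div_le_one (by linarith)]; exact hx
  rw [abs_le]; constructor <;> linarith

lemma digamma_shift (x s : ℝ) (hs : 0 < s) (k : ℕ) (hx : ∀ j : ℕ, s ≤ |x + j|) :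
    |digamma x| ≤ |digamma (x + k)| + k / s := by
  induction k with
  | zero => simp
  | succ k ih =>
    have h1 : digamma (x + k + 1) = digamma (x + k) + 1 / (x + k) := by
      apply digamma_succ
      intro m h
      have := hx (k + m)
      push_cast at this
      rw [← add_assoc, h] at this
      simp at this; linarith
    have h2 : |1 / (x + k)| ≤ 1 / s := by
      rw [abs_div, abs_one]
      exact one_div_le_one_div_of_le hs (hx k)
    have h3 : |digamma (x+k)| ≤ |digamma (x + k + 1)| + |1 / (x+k)| := by
      have : digamma (x+k) = digamma (x + k + 1) - 1 / (x+k) := by rw [h1]; ring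
      rw [this]; exact abs_sub _ _
    push_cast
    rw [← add_assoc, add_div]
    linarith

noncomputable def eK (θ : ℝ) (i : ℕ) : ℝ := digamma (θ + i) - digamma (1 + i) - digamma (2 + i)
noncomputable def dK (θ : ℝ) (i : ℕ) : ℝ := kummerCoeff θ i * eK θ i

lemma kum_zero (θ : ℝ) : kummerCoeff θ 0 = 1 := by simp [kummerCoeff]

lemma kum_succ (θ : ℝ) (i : ℕ) : ((i:ℝ) + 1) * (i + 2) * kummerCoeff θ (i+1) = (θ + i) * kummerCoeff θ i := by
  unfold kummerCoeff
  rw [ascPochhammer_succ_eval, ascPochhammer_succ_eval, Nat.factorial_succ]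
  have : (ascPochhammer ℝ i).eval 2 ≠ 0 := (ascPochhammer_pos i 2 (by norm_num)).ne'
  push_cast
  have : (i:ℝ) + 1 ≠ 0 := by positivity
  have : (2:ℝ) + i ≠ 0 := by positivity
  field_simp
  try ring

lemma kum_PB (n : ℕ) (θ : ℝ) (hθ : |θ| ≤ n + 1) : PB 1 (n + 1) (kummerCoeff θ) := by
  intro i
  induction i with
  | zero => simp [kum_zero]
  | succ i ih =>
    have h := kum_succ θ i
    have h1 : kummerCoeff θ (i+1) = (θ + i) / (i + 2) * (kummerCoeff θ i / (i + 1)) := by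
      field_simp; linear_combination h
    rw [h1, abs_mul, abs_div, abs_div, abs_of_pos (by positivity : (0:ℝ) < i + 1), abs_of_pos (by positivity : (0:ℝ) < i + 2)]
    have h2 : |θ + i| / (i + 2) ≤ n + 1 := by
      rw [div_le_iff₀ (by positivity)]
      have := abs_add_le θ i
      rw [Nat.abs_cast] at this
      have : (0:ℝ) ≤ n * i := by positivity
      nlinarith
    calc |θ + i| / (i + 2) * (|kummerCoeff θ i| / (i + 1)) ≤ (n + 1) * ((1 * ((n + 1) ^ i / (i.factorial : ℝ))) / (i + 1)) := by gcongr
      _ = _ := by rw [Nat.factorial_succ]; push_cast; field_simp; ring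

lemma eK_bd (n : ℕ) (θ s : ℝ) (hθ : |θ| ≤ n + 1) (hθ1 : 1 ≤ θ + n + 1) (hs : 0 < s) (hx : ∀ j : ℕ, s ≤ |θ + j|) (i : ℕ) :
    |eK θ i| ≤ (2 * n + 6 + (n + 1) / s) * (i + 1) := by
  have h1 : |digamma (θ + i)| ≤ |digamma (θ + i + (n + 1 : ℕ))| + (n + 1 : ℕ) / s := digamma_shift _ s hs _ (fun j => by
    have := hx (i + j)
    push_cast at this
    rwa [← add_assoc] at this)
  have hi : (0:ℝ) ≤ i := Nat.cast_nonneg i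
  have h2 : |digamma (θ + i + (n + 1 : ℕ))| ≤ θ + i + (n + 1 : ℕ) := digamma_abs _ (by push_cast; linarith)
  have h3 : |digamma (1 + i)| ≤ 1 + i := digamma_abs _ (by linarith)
  have h4 : |digamma (2 + i)| ≤ 2 + i := digamma_abs _ (by linarith)
  have h5 : |eK θ i| ≤ |digamma (θ + i)| + |digamma (1 + i)| + |digamma (2 + i)| := by
    unfold eK
    exact (abs_sub _ _).trans (add_le_add_left (abs_sub _ _) _)
  have h6 := le_abs_self θ
  push_cast at h1 h2
  have h7 : 0 ≤ (n + 1) / s * i := by positivity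
  have h8 : 0 ≤ (n:ℝ) * i := by positivity
  nlinarith

lemma dK_PB (n : ℕ) (θ s : ℝ) (hθ : |θ| ≤ n + 1) (hθ1 : 1 ≤ θ + n + 1) (hs : 0 < s) (hx : ∀ j : ℕ, s ≤ |θ + j|) :
    PB (2 * n + 6 + (n + 1) / s) (2 * (n + 1)) (dK θ) := by
  intro i
  have h1 := kum_PB n θ hθ i
  have h2 := eK_bd n θ s hθ hθ1 hs hx i
  unfold dK
  rw [abs_mul]
  have h3 : (i:ℝ) + 1 ≤ 2 ^ i := by exact_mod_cast Nat.lt_two_pow_self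
  calc _ ≤ (1 * ((n + 1) ^ i / (i.factorial : ℝ))) * ((2 * n + 6 + (n + 1) / s) * 2 ^ i) := by
        gcongr; exact h2.trans (by gcongr)
    _ = _ := by rw [mul_pow]; ring

lemma eK_succ (θ : ℝ) (hθ : ∀ m : ℕ, θ ≠ -m) (i : ℕ) : eK θ (i+1) = eK θ i + 1 / (θ + i) - 1 / (i + 1) - 1 / (i + 2) := by
  have hne : ∀ y : ℝ, 0 < y → ∀ m : ℕ, y ≠ -m := fun y hy m h => by
    have : (0:ℝ) ≤ m := Nat.cast_nonneg m
    linarith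
  have h1 := digamma_succ (θ + i) (fun m h => hθ (i + m) (by push_cast; linarith))
  have h2 := digamma_succ (1 + i) (hne _ (by positivity))
  have h3 := digamma_succ (2 + i) (hne _ (by positivity))
  unfold eK
  push_cast
  rw [← add_assoc, ← add_assoc, ← add_assoc, h1, h2, h3, add_comm (1:ℝ) i, add_comm (2:ℝ) i]
  ring

lemma dK_succ (θ : ℝ) (hθ : ∀ m : ℕ, θ ≠ -m) (i : ℕ) : ((i:ℝ) + 1) * (i + 2) * dK θ (i+1) =
    (θ + i) * dK θ i + kummerCoeff θ i - (2 * i + 3) * kummerCoeff θ (i + 1) := by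
  have h := kum_succ θ i
  have h0 : θ + i ≠ 0 := fun h => hθ i (by linarith)
  unfold dK
  rw [eK_succ θ hθ]
  have h1 : kummerCoeff θ i = (i + 1) * (i + 2) * kummerCoeff θ (i + 1) / (θ + i) := by field_simp; linear_combination -h
  rw [h1]
  field_simp
  ring


lemma psM_ode {A ρ θ : ℝ} {c : ℕ → ℝ} (hc : PB A ρ c) (hr : ∀ i : ℕ, ((i:ℝ) + 1) * (i + 2) * c (i+1) = (θ + i) * c i) (z : ℝ) :
    z * ps (psd (psd c)) z + (2 - z) * ps (psd c) z - θ * ps c z = 0 := by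
  have h := (((hc.psd.hasSum_zd z).add ((hc.psd.hasSum z).mul_left 2)).sub (hc.hasSum_zd z)).sub ((hc.hasSum z).mul_left θ)
  have h0 : HasSum (fun _ : ℕ => (0:ℝ)) (z * ps (psd (psd c)) z + 2 * ps (psd c) z - z * ps (psd c) z - θ * ps c z) := by
    refine h.congr_fun fun i => ?_
    have := hr i
    simp only [psd]
    linear_combination (-z ^ i) * this
  have := h0.unique hasSum_zero
  linarith

lemma psD_ode {A ρ A' ρ' θ : ℝ} {c d : ℕ → ℝ} (hc : PB A ρ c) (hd : PB A' ρ' d) (c0 : c 0 = 1)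
    (hr : ∀ i : ℕ, ((i:ℝ) + 1) * (i + 2) * d (i+1) = (θ + i) * d i + c i - (2 * i + 3) * c (i + 1)) (z : ℝ) (hz : z ≠ 0) :
    z * ps (psd (psd d)) z + (2 - z) * ps (psd d) z - θ * ps d z = ps c z - 2 * ps (psd c) z - (ps c z - 1) / z := by
  have hsh : HasSum (fun i : ℕ => c (i + 1) * z ^ i) ((ps c z - 1) / z) := by
    have h1 := (hasSum_nat_add_iff' 1).2 (hc.hasSum z)
    simp only [Finset.range_one, Finset.sum_singleton, pow_zero, mul_one, c0] at h1
    refine (h1.div_const z).congr_fun fun i => ?_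
    field_simp
    ring
  have h := (((((hd.psd.hasSum_zd z).add ((hd.psd.hasSum z).mul_left 2)).sub (hd.hasSum_zd z)).sub ((hd.hasSum z).mul_left θ)).sub
    (hc.hasSum z)).add (((hc.psd.hasSum z).mul_left 2).add hsh)
  have h0 := (h.congr_fun (g := fun _ : ℕ => (0:ℝ)) fun i => by
    have := hr i
    simp only [psd]
    linear_combination (-z ^ i) * this)
  have := h0.unique hasSum_zero
  linarith

noncomputable def Hs (θ : ℝ) (c d : ℕ → ℝ) (z : ℝ) : ℝ := 1 / z + (θ - 1) * (log z * ps c z + ps d z)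
noncomputable def Hs1 (θ : ℝ) (c d : ℕ → ℝ) (z : ℝ) : ℝ :=
  -1 / z ^ 2 + (θ - 1) * (ps c z / z + log z * ps (psd c) z + ps (psd d) z)

lemma Hs_deriv {A ρ A' ρ' θ : ℝ} {c d : ℕ → ℝ} (hc : PB A ρ c) (hd : PB A' ρ' d) (z : ℝ) (hz : z ≠ 0) :
    HasDerivAt (Hs θ c d) (Hs1 θ c d z) z := by
  have h1 : HasDerivAt (fun z : ℝ => 1 / z) (-1 / z ^ 2) z := by
    have := hasDerivAt_inv hz
    simp only [one_div]
    exact this.congr_deriv (by field_simp)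
  have h2 := h1.add ((((hasDerivAt_log hz).mul (hc.hasDeriv z)).add (hd.hasDeriv z)).const_mul (θ - 1))
  refine h2.congr_deriv ?_
  unfold Hs1
  field_simp

lemma Hs1_deriv {A ρ A' ρ' θ : ℝ} {c d : ℕ → ℝ} (hc : PB A ρ c) (hd : PB A' ρ' d) (c0 : c 0 = 1)
    (hr : ∀ i : ℕ, ((i:ℝ) + 1) * (i + 2) * c (i+1) = (θ + i) * c i)
    (hr' : ∀ i : ℕ, ((i:ℝ) + 1) * (i + 2) * d (i+1) = (θ + i) * d i + c i - (2 * i + 3) * c (i + 1))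
    (z : ℝ) (hz : z ≠ 0) :
    HasDerivAt (Hs1 θ c d) ((1 - 2 / z) * Hs1 θ c d z + θ / z * Hs θ c d z) z := by
  have h1 : HasDerivAt (fun z : ℝ => -1 / z ^ 2) (2 / z ^ 3) z := by
    have := ((hasDerivAt_const z (-1:ℝ)).div (hasDerivAt_pow 2 z) (by positivity))
    exact this.congr_deriv (by field_simp; norm_num; ring)
  have h2 := h1.add (((((hc.hasDeriv z).div (hasDerivAt_id z) hz).add ((hasDerivAt_log hz).mul (hc.psd.hasDeriv z))).add
    (hd.psd.hasDeriv z)).const_mul (θ - 1))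
  refine h2.congr_deriv ?_
  unfold Hs1 Hs
  have e1 := psM_ode hc hr z
  have e2 := psD_ode hc hd c0 hr' z hz
  simp only [id]
  generalize ps (psd (psd c)) z = C2 at *
  generalize ps (psd (psd d)) z = D2 at *
  have e1' : C2 = (θ * ps c z - (2 - z) * ps (psd c) z) / z := by field_simp; linear_combination e1
  have e2' : D2 = (ps c z - 2 * ps (psd c) z - (ps c z - 1) / z + θ * ps d z - (2 - z) * ps (psd d) z) / z := by
    rw [eq_div_iff hz]; linear_combination e2
  rw [e1', e2']
  field_simp
  ring

lemma psM1_deriv {A ρ θ : ℝ} {c : ℕ → ℝ} (hc : PB A ρ c) 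
    (hr : ∀ i : ℕ, ((i:ℝ) + 1) * (i + 2) * c (i+1) = (θ + i) * c i) (z : ℝ) (hz : z ≠ 0) :
    HasDerivAt (ps (psd c)) ((1 - 2 / z) * ps (psd c) z + θ / z * ps c z) z := by
  refine (hc.psd.hasDeriv z).congr_deriv ?_
  have e1 := psM_ode hc hr z
  field_simp
  linear_combination e1

/-- relation with hKum -/
lemma hKum_eq (n : ℕ) (θ s : ℝ) (hθ : |θ| ≤ n + 1) (hθ1 : 1 ≤ θ + n + 1) (hs : 0 < s) (hx : ∀ j : ℕ, s ≤ |θ + j|)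
    (h1 : θ ≠ 1) (z : ℝ) : Real.Gamma θ * hKum θ z = Hs θ (kummerCoeff θ) (dK θ) z := by
  have hne : ∀ m : ℕ, θ ≠ -m := fun m h => by
    have := hx m
    rw [h] at this; simp at this; linarith
  have hG := Real.Gamma_ne_zero hne
  have hG1 : Real.Gamma (θ - 1) ≠ 0 := Real.Gamma_ne_zero (fun m h => by
    rcases m with _ | m
    · simp at h; apply h1; linarith
    · apply hne m; push_cast at h; linarith)
  have hrel : Real.Gamma θ = (θ - 1) * Real.Gamma (θ - 1) := by
    have := Real.Gamma_add_one (s := θ - 1) (sub_ne_zero.2 h1)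
    simpa using this
  have hsum : ∑' i : ℕ, kummerCoeff θ i * z ^ i
            * (Real.log z + digamma (θ + i) - digamma (1 + i) - digamma (2 + i)) = log z * ps (kummerCoeff θ) z + ps (dK θ) z := by
    have := (((kum_PB n θ hθ).hasSum z).mul_left (log z)).add ((dK_PB n θ s hθ hθ1 hs hx).hasSum z)
    rw [← this.tsum_eq]
    refine tsum_congr fun i => ?_
    simp only [dK, eK]; ring
  unfold hKum Hs
  rw [hsum]
  have h3 : Real.Gamma θ * (1 / Real.Gamma (θ - 1)) = θ - 1 := by rw [hrel]; field_simp
  rw [mul_add, ← mul_assoc, h3]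
  congr 1
  by_cases hz : z = 0
  · simp [hz]
  field_simp


lemma PB.nonneg {A ρ : ℝ} {a : ℕ → ℝ} (h : PB A ρ a) : 0 ≤ A := by
  have := h 0
  simp at this
  exact (abs_nonneg _).trans this

lemma PB.mul_bdd {A ρ B : ℝ} {a x : ℕ → ℝ} (h : PB A ρ a) (hx : ∀ i, |x i| ≤ B) : PB (B * A) ρ (fun i => a i * x i) := by
  intro i
  rw [abs_mul, mul_comm, mul_assoc]
  have := h i
  have hB : 0 ≤ B := (abs_nonneg _).trans (hx i)
  gcongr
  exact hx i

lemma PB.shift {A ρ : ℝ} {a : ℕ → ℝ} (hρ : 0 ≤ ρ) (h : PB A ρ a) (n : ℕ) : PB (A * ρ ^ n) ρ (fun i => a (i + n)) := by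
  intro i
  refine (h (i + n)).trans ?_
  have hA := h.nonneg
  have : (i.factorial : ℝ) ≤ ((i+n).factorial : ℝ) := by exact_mod_cast Nat.factorial_le (by omega)
  calc _ ≤ A * (ρ ^ (i + n) / (i.factorial : ℝ)) := by gcongr
    _ = _ := by rw [pow_add]; ring

lemma PB.const {A ρ : ℝ} {a : ℕ → ℝ} (h : PB A ρ a) (k : ℝ) : PB (|k| * A) ρ (fun i => a i * k) :=
  h.mul_bdd (x := fun _ => k) (fun _ => le_rfl)

lemma ps_lower {A ρ : ℝ} {p : ℕ → ℝ} (h : PB A ρ p) (hp : ∀ i, 0 < p i) (z : ℝ) (hz : 0 ≤ z) (i : ℕ) :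
    p i * z ^ i ≤ ps p z :=
  (h.summable z).le_tsum i (fun j _ => mul_nonneg (hp j).le (pow_nonneg hz j))

lemma bdd_of_lim {x : ℕ → ℝ} (hx : Tendsto x atTop (𝓝 0)) : ∃ B, ∀ i, |x i| ≤ B := by
  obtain ⟨B, hB⟩ := (hx.abs.bddAbove_range)
  exact ⟨B, fun i => hB ⟨i, rfl⟩⟩

lemma wavg {A ρ : ℝ} {p x : ℕ → ℝ} (h : PB A ρ p) (hp : ∀ i, 0 < p i) (hx : Tendsto x atTop (𝓝 0)) :
    Tendsto (fun z => ps (fun i => p i * x i) z / ps p z) atTop (𝓝 0) := by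
  obtain ⟨B, hB⟩ := bdd_of_lim hx
  have hpx := h.mul_bdd hB
  rw [Metric.tendsto_nhds]
  intro ε hε
  obtain ⟨N, hN⟩ := Filter.eventually_atTop.1 ((Metric.tendsto_nhds.1 hx) (ε/2) (by linarith))
  have hlow : Tendsto (fun z => ∑ i ∈ Finset.range N, |p i * x i| * (1 / p (i+1) * z⁻¹)) atTop (𝓝 0) := by
    have : (0:ℝ) = ∑ i ∈ Finset.range N, |p i * x i| * (1 / p (i+1) * 0) := by simp
    rw [this]
    exact tendsto_finsetSum _ fun i _ => (tendsto_inv_atTop_zero.const_mul _).const_mul _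
  filter_upwards [hlow.eventually (gt_mem_nhds (by linarith : 0 < ε / 2)), eventually_ge_atTop 1] with z hz hz1
  have hz0 : 0 < z := by linarith
  have hPpos : 0 < ps p z := (mul_pos (hp 0) (pow_pos hz0 0)).trans_le (ps_lower h hp z hz0.le 0)
  rw [Real.dist_eq, sub_zero, abs_div, abs_of_pos hPpos, div_lt_iff₀ hPpos]
  have s1 : HasSum (fun i => if i < N then |p i * x i| * z ^ i else 0) (∑ i ∈ Finset.range N, if i < N then |p i * x i| * z ^ i else 0) :=
    hasSum_sum_of_ne_finset_zero (fun i hi => by simp at hi; rw [if_neg (by omega)])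
  have s2 := s1.add ((h.hasSum z).mul_left (ε / 2))
  have h3 := tsum_of_norm_bounded s2 (f := fun i => (p i * x i) * z ^ i) (fun i => by
    rw [Real.norm_eq_abs, abs_mul, abs_of_pos (pow_pos hz0 i)]
    have hpz : 0 ≤ p i * z ^ i := mul_nonneg (hp i).le (pow_nonneg hz0.le i)
    split_ifs with hi
    · have : 0 ≤ ε / 2 * (p i * z ^ i) := by positivity
      linarith
    · have := hN i (by omega)
      rw [Real.dist_eq, sub_zero] at this
      rw [abs_mul, abs_of_pos (hp i), zero_add]
      calc _ = |x i| * (p i * z ^ i) := by ring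
        _ ≤ _ := by gcongr)
  rw [Real.norm_eq_abs] at h3
  have h4 : (∑ i ∈ Finset.range N, if i < N then |p i * x i| * z ^ i else 0) ≤
      (∑ i ∈ Finset.range N, |p i * x i| * (1 / p (i+1) * z⁻¹)) * ps p z := by
    rw [Finset.sum_mul]
    refine Finset.sum_le_sum fun i hi => ?_
    rw [if_pos (by simpa using hi), mul_assoc]
    refine mul_le_mul_of_nonneg_left ?_ (abs_nonneg _)
    have := ps_lower h hp z hz0.le (i+1)
    calc z ^ i = (1 / p (i+1) * z⁻¹) * (p (i+1) * z ^ (i+1)) := by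
          have := (hp (i+1)).ne'
          rw [pow_succ]; field_simp
      _ ≤ _ := by
          have := hp (i+1)
          gcongr
  have h5 : (∑ i ∈ Finset.range N, |p i * x i| * (1 / p (i+1) * z⁻¹)) * ps p z < ε / 2 * ps p z :=
    mul_lt_mul_of_pos_right hz hPpos
  change |ps (fun i => p i * x i) z| < _
  change |ps (fun i => p i * x i) z| ≤ _ at h3
  have : (∑ i ∈ Finset.range N, if i < N then |p i * x i| * z ^ i else 0) + ε / 2 * ps p z < ε * ps p z := by linarith
  exact h3.trans_lt this


lemma lim_rat (α β : ℝ) : Tendsto (fun i : ℕ => ((i:ℝ) + α) / (i + β)) atTop (𝓝 1) := by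
  have h1 : Tendsto (fun i : ℕ => (i:ℝ) + β) atTop atTop :=
    tendsto_atTop_add_const_right _ _ tendsto_natCast_atTop_atTop
  have h2 : Tendsto (fun i : ℕ => 1 + (α - β) * ((i:ℝ) + β)⁻¹) atTop (𝓝 (1 + (α - β) * 0)) :=
    ((tendsto_inv_atTop_zero.comp h1).const_mul _).const_add _
  simp only [mul_zero, add_zero] at h2
  refine h2.congr' ?_
  filter_upwards [h1.eventually_gt_atTop 0] with i hi
  field_simp
  ring

lemma T_lim (n : ℕ) {A ρ A' ρ' τ : ℝ} (hτ : 0 < τ) {p e : ℕ → ℝ} (h : PB A ρ p) (hp : ∀ i, 0 < p i)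
    (he : PB A' ρ' (fun i => p i * e i))
    (hr : ∀ i : ℕ, ((i:ℝ) + n + 1) * (i + n + 2) * p (i+1) = (τ + i) * p i)
    (hx : Tendsto (fun i : ℕ => e i + log (i + n + 1)) atTop (𝓝 0)) :
    Tendsto (fun z => (log z * ps p z + ps (fun i => p i * e i) z) / ps p z) atTop (𝓝 0) := by
  obtain ⟨B, hB⟩ := bdd_of_lim hx
  have hpx := h.mul_bdd hB
  -- upper
  let y : ℕ → ℝ := fun i => match i with | 0 => -1 | (j+1) => (j + (n + 2)) / (j + τ) - 1
  have hy : Tendsto y atTop (𝓝 0) := by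
    rw [← tendsto_add_atTop_iff_nat 1]
    have := (lim_rat (n+2) τ).sub_const 1
    rwa [sub_self] at this
  have hu : Tendsto (fun i : ℕ => 1 - ((i:ℝ) + τ) / (i + (n+1)) * ((i + 1) / (i + (n + 2)))) atTop (𝓝 0) := by
    have := ((lim_rat τ (n+1)).mul (lim_rat 1 (n+2))).const_sub 1
    simpa using this
  obtain ⟨By, hBy⟩ := bdd_of_lim hy
  obtain ⟨Bu, hBu⟩ := bdd_of_lim hu
  have L1 := (wavg h hp hy).add (wavg h hp hx)
  have L2 := ((wavg h hp hu).sub (tendsto_inv_atTop_zero.const_mul ((n:ℝ)+1))).add (wavg h hp hx)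
  simp only [add_zero, mul_zero, sub_zero] at L1 L2
  refine tendsto_of_tendsto_of_tendsto_of_le_of_le' L2 L1 ?_ ?_
  · filter_upwards [eventually_gt_atTop 0] with z hz
    have hPpos : 0 < ps p z := (mul_pos (hp 0) (pow_pos hz 0)).trans_le (ps_lower h hp z hz.le 0)
    have s1 := ((h.hasSum z).mul_left (log z)).add (he.hasSum z)
    have s2 := (((h.hasSum z).sub (h.psd.hasSum z)).sub ((h.hasSum z).mul_left (((n:ℝ)+1) * z⁻¹))).add (hpx.hasSum z)
    have s3 : HasSum _ (ps p z - ps (psd p) z) := ((h.hasSum z).sub (h.psd.hasSum z)).congr_fun (g := fun i : ℕ => p i * (1 - ((i:ℝ) + τ) / (i + (n+1)) * ((i + 1) / (i + (n + 2)))) * z ^ i) (fun i => by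
      have := hr i
      have h1 : p (i+1) = (τ + i) * p i / ((i + n + 1) * (i + n + 2)) := by field_simp; linear_combination this
      simp only [psd, h1]
      have : (i:ℝ) + (n+1) ≠ 0 := by positivity
      have : (i:ℝ) + n+1 ≠ 0 := by positivity
      have : (i:ℝ) + (n+2) ≠ 0 := by positivity
      have : (i:ℝ) + n+2 ≠ 0 := by positivity
      field_simp
      ring)
    have e3 : ps p z - ps (psd p) z = ps (fun i : ℕ => p i * (1 - ((i:ℝ) + τ) / (i + (n+1)) * ((i + 1) / (i + (n + 2))))) z :=
      s3.tsum_eq.symm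
    have s4 := (((h.hasSum z).sub ((h.hasSum_zd z).mul_left z⁻¹)).sub ((h.hasSum z).mul_left (((n:ℝ)+1) * z⁻¹))).add (hpx.hasSum z)
    have key := hasSum_le (fun i => by
      have hpz : 0 ≤ p i * z ^ i := mul_nonneg (hp i).le (pow_nonneg hz.le i)
      have hk : (0:ℝ) < i + n + 1 := by positivity
      have hl : 1 - (i + n + 1) / z ≤ log z - log (i + n + 1) := by
        have := Real.one_sub_inv_le_log_of_pos (div_pos hz hk)
        rw [inv_div, Real.log_div hz.ne' hk.ne'] at this
        exact this
      have := mul_le_mul_of_nonneg_left hl hpz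
      show _ ≤ log z * (p i * z ^ i) + p i * e i * z ^ i
      have e1 : p i * z ^ i - z⁻¹ * (i * p i * z ^ i) - (n + 1) * z⁻¹ * (p i * z ^ i) = p i * z ^ i * (1 - (i + n + 1) / z) := by
        field_simp; ring
      rw [e1]
      linarith) s4 s1
    have hzz : z⁻¹ * (z * ps (psd p) z) = ps (psd p) z := by field_simp
    rw [hzz, e3] at key
    rw [le_div_iff₀ hPpos]
    refine le_trans (le_of_eq ?_) key
    field_simp
  · filter_upwards [eventually_gt_atTop 0] with z hz
    have hPpos : 0 < ps p z := (mul_pos (hp 0) (pow_pos hz 0)).trans_le (ps_lower h hp z hz.le 0)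
    have s1 := ((h.hasSum z).mul_left (log z)).add (he.hasSum z)
    have hq : PB (1 * A) ρ (fun i : ℕ => p i * (1 / ((i:ℝ) + n + 1))) := h.mul_bdd (fun i => by
      have hk : (0:ℝ) < i + n + 1 := by positivity
      rw [abs_of_pos (by positivity), div_le_one hk]
      have : (0:ℝ) ≤ i + n := by positivity
      linarith)
    have s3 : HasSum _ (z * ps (fun i : ℕ => p i * (1 / ((i:ℝ) + n + 1))) z - ps p z) := ((hq.hasSum_mul z).sub (h.hasSum z)).congr_fun (g := fun i : ℕ => p i * y i * z ^ i) (fun i => by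
      rcases i with _ | i
      · simp [y]
      · simp only [y]
        have := hr i
        have h1 : p i = p (i+1) * ((i + n + 1) * (i + n + 2)) / (i + τ) := by field_simp; linear_combination -this
        rw [h1]
        field_simp
        ring)
    have e3 := s3.tsum_eq
    have s4 := (((hq.hasSum z).mul_left z).sub (h.hasSum z)).add (hpx.hasSum z)
    have key := hasSum_le (fun i => by
      have hpz : 0 ≤ p i * z ^ i := mul_nonneg (hp i).le (pow_nonneg hz.le i)
      have hk : (0:ℝ) < i + n + 1 := by positivity
      have hl : log z - log (i + n + 1) ≤ z / (i + n + 1) - 1 := by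
        have := Real.log_le_sub_one_of_pos (div_pos hz hk)
        rw [Real.log_div hz.ne' hk.ne'] at this
        exact this
      have := mul_le_mul_of_nonneg_left hl hpz
      show log z * (p i * z ^ i) + p i * e i * z ^ i ≤ _
      have e1 : z * (p i * (1 / ((i:ℝ) + n + 1)) * z ^ i) - p i * z ^ i = p i * z ^ i * (z / (i + n + 1) - 1) := by
        field_simp
      rw [e1]
      linarith) s1 s4
    change ps (fun i => p i * y i) z = _ at e3
    rw [← e3] at key
    rw [div_le_iff₀ hPpos]
    refine key.trans (le_of_eq ?_)
    field_simp


lemma ps_split {A ρ : ℝ} {a : ℕ → ℝ} (h : PB A ρ a) (n : ℕ) (z : ℝ) :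
    ps a z = ∑ i ∈ Finset.range n, a i * z ^ i + z ^ n * ps (fun i => a (i + n)) z := by
  rw [ps, ← (h.summable z).sum_add_tsum_nat_add n]
  congr 1
  rw [ps, ← tsum_mul_left]
  refine tsum_congr fun i => ?_
  rw [pow_add]; ring

lemma low_lim (n : ℕ) (a : ℕ → ℝ) (f W : ℝ → ℝ) (hf : Tendsto (fun z => f z * z⁻¹) atTop (𝓝 0)) (hW : ∀ z, 1 ≤ z → z ^ n ≤ W z) :
    Tendsto (fun z => f z * (∑ i ∈ Finset.range n, a i * z ^ i) / W z) atTop (𝓝 0) := by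
  have h1 : Tendsto (fun z => ∑ i ∈ Finset.range n, |a i| * |f z * z⁻¹|) atTop (𝓝 0) := by
    have : (0:ℝ) = ∑ i ∈ Finset.range n, |a i| * |0| := by simp
    rw [this]
    exact tendsto_finsetSum _ fun i _ => hf.abs.const_mul _
  refine squeeze_zero_norm' ?_ h1
  filter_upwards [eventually_ge_atTop 1] with z hz
  have hz0 : 0 < z := by linarith
  have hW0 : 0 < W z := (pow_pos hz0 n).trans_le (hW z hz)
  rw [Real.norm_eq_abs, abs_div, abs_of_pos hW0, div_le_iff₀ hW0, abs_mul, Finset.sum_mul]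
  calc _ ≤ |f z| * ∑ i ∈ Finset.range n, |a i * z ^ i| := by gcongr; exact Finset.abs_sum_le_sum_abs _ _
    _ = ∑ i ∈ Finset.range n, |f z| * |a i * z ^ i| := by rw [Finset.mul_sum]
    _ ≤ _ := by
        refine Finset.sum_le_sum fun i hi => ?_
        rw [abs_mul, abs_of_pos (pow_pos hz0 i), abs_mul, abs_of_pos (inv_pos.2 hz0)]
        have h2 : z ^ i ≤ z⁻¹ * W z := by
          have : z ^ (i+1) ≤ z ^ n := pow_le_pow_right₀ hz (by simpa using hi)
          rw [inv_mul_eq_div, le_div_iff₀ hz0, ← pow_succ]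
          exact this.trans (hW z hz)
        calc _ = |a i| * |f z| * z ^ i := by ring
          _ ≤ |a i| * |f z| * (z⁻¹ * W z) := by gcongr
          _ = _ := by ring

lemma eK_lim (n : ℕ) (θ : ℝ) (hτ : 0 < θ + n) : Tendsto (fun i : ℕ => eK θ (i + n) + log (i + n + 1)) atTop (𝓝 0) := by
  have dl : ∀ β : ℝ, 0 < β → Tendsto (fun i : ℕ => digamma (i + β) - log (i + β)) atTop (𝓝 0) := by
    intro β hβ
    have h1 : Tendsto (fun i : ℕ => (i:ℝ) + β) atTop atTop :=
      tendsto_atTop_add_const_right _ _ tendsto_natCast_atTop_atTop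
    refine squeeze_zero_norm (fun i => ?_) (tendsto_inv_atTop_zero.comp h1)
    have := digamma_bd (i + β) (by positivity)
    rw [Real.norm_eq_abs, abs_le]
    simp only [Function.comp]
    rw [one_div] at this
    have : (0:ℝ) < (i + β)⁻¹ := by positivity
    constructor <;> linarith
  have l1 : Tendsto (fun i : ℕ => log (((i:ℝ) + (θ + n)) / (i + (n+2)))) atTop (𝓝 (log 1)) :=
    (lim_rat _ _).log one_ne_zero
  rw [log_one] at l1
  have := (((dl (θ + n) hτ).sub (dl (n + 1) (by positivity))).sub (dl (n+2) (by positivity))).add l1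
  simp only [sub_zero, add_zero] at this
  refine this.congr fun i => ?_
  have h1 : (0:ℝ) < i + (θ + n) := by positivity
  rw [Real.log_div h1.ne' (by positivity)]
  unfold eK
  push_cast
  have e1 : θ + ((i:ℝ) + n) = i + (θ + n) := by ring
  have e2 : 1 + ((i:ℝ) + n) = i + (n + 1) := by ring
  have e3 : 2 + ((i:ℝ) + n) = i + (n + 2) := by ring
  have e4 : ((i:ℝ) + n) + 1 = i + (n + 1) := by ring
  rw [e1, e2, e3, e4]
  ring

lemma kum_asym (n : ℕ) (θ s : ℝ) (hτ : 0 < θ + n) (hτ1 : θ + n < 1) (hs : 0 < s) (hx : ∀ j : ℕ, s ≤ |θ + j|) :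
    ∃ W : ℝ → ℝ, (∀ z, 1 ≤ z → z ^ n ≤ W z) ∧ (∃ k, k ≠ 0 ∧ Tendsto (fun z => ps (kummerCoeff θ) z / W z) atTop (𝓝 k)) ∧
      Tendsto (fun z => Hs θ (kummerCoeff θ) (dK θ) z / W z) atTop (𝓝 0) := by
  have hn0 : (0:ℝ) ≤ n := Nat.cast_nonneg n
  have hθ : |θ| ≤ n + 1 := by rw [abs_le]; constructor <;> linarith
  have hθ1 : 1 ≤ θ + n + 1 := by linarith
  set c := kummerCoeff θ with hc
  have cPB : PB 1 (n+1) c := kum_PB n θ hθ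
  have dPB := dK_PB n θ s hθ hθ1 hs hx
  have hr := kum_succ θ
  rw [← hc] at hr
  have hcne : ∀ i, c i ≠ 0 := by
    intro i
    induction i with
    | zero => rw [hc, kum_zero]; norm_num
    | succ i ih =>
      intro h0
      have := hr i
      rw [h0, mul_zero] at this
      rcases mul_eq_zero.1 this.symm with h | h
      · have := hx i; rw [h] at this; simp at this; linarith
      · exact ih h
  set p : ℕ → ℝ := fun i => c (i + n) * (c n)⁻¹ with hpdef
  have pPB := (cPB.shift (by positivity) n).const (c n)⁻¹
  have pr : ∀ i : ℕ, ((i:ℝ) + n + 1) * (i + n + 2) * p (i+1) = (θ + n + i) * p i := by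
    intro i
    have := hr (i + n)
    simp only [hpdef]
    push_cast at this
    rw [show i + 1 + n = i + n + 1 by ring]
    linear_combination (c n)⁻¹ * this
  have ppos : ∀ i, 0 < p i := by
    intro i
    induction i with
    | zero => simp [hpdef, hcne n]
    | succ i ih =>
      have := pr i
      have h2 : 0 < (θ + n + i) * p i := by positivity
      rw [← this] at h2
      exact (pos_iff_pos_of_mul_pos h2).1 (by positivity)
  have ePB0 := (dPB.shift (by positivity) n).const (c n)⁻¹
  obtain ⟨A1, ρ1, ePB⟩ : ∃ A1 ρ1, PB A1 ρ1 (fun i => p i * eK θ (i + n)) := by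
    have e : (fun i => p i * eK θ (i + n)) = (fun i => dK θ (i + n) * (c n)⁻¹) := by
      funext i; simp only [hpdef, dK, hc]; ring
    rw [e]; exact ⟨_, _, ePB0⟩
  have hT : Tendsto (fun z => (log z * ps p z + ps (fun i => p i * eK θ (i + n)) z) / ps p z) atTop (𝓝 0) := T_lim n hτ pPB ppos ePB pr (eK_lim n θ hτ)
  have hP1 : ∀ z, 0 ≤ z → 1 ≤ ps p z := fun z hz => by
    have := ps_lower pPB ppos z hz 0
    simpa [hpdef, hcne n] using this
  have hW : ∀ z, 1 ≤ z → z ^ n ≤ z ^ n * ps p z := fun z hz => by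
    have := hP1 z (by linarith)
    have h2 : 0 < z ^ n := pow_pos (by linarith) n
    nlinarith
  have hcp : ∀ z, ps (fun i => c (i + n)) z = c n * ps p z := fun z => by
    rw [ps, ps, ← tsum_mul_left]
    refine tsum_congr fun i => ?_
    simp only [hpdef]; have := hcne n; field_simp
  have hdp : ∀ z, ps (fun i => dK θ (i + n)) z = c n * ps (fun i => p i * eK θ (i + n)) z := fun z => by
    rw [ps, ps, ← tsum_mul_left]
    refine tsum_congr fun i => ?_
    simp only [hpdef, dK, ← hc]; have := hcne n; field_simp
  refine ⟨fun z => z ^ n * ps p z, hW, ⟨c n, hcne n, ?_⟩, ?_⟩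
  · have := (low_lim n c (fun _ => 1) _ (by simpa using tendsto_inv_atTop_zero) hW).add_const (c n)
    rw [zero_add] at this
    refine this.congr' ?_
    filter_upwards [eventually_ge_atTop 1] with z hz
    have hz0 : 0 < z := by linarith
    have := hP1 z hz0.le
    rw [ps_split cPB n z, hcp]
    field_simp
  · have l1 := (low_lim n c log _ (by
      have := Real.isLittleO_log_id_atTop.tendsto_div_nhds_zero
      simpa [div_eq_mul_inv] using this) hW)
    have l2 := (low_lim n (dK θ) (fun _ => 1) _ (by simpa using tendsto_inv_atTop_zero) hW)
    have l3 : Tendsto (fun z => 1 / z / (z ^ n * ps p z)) atTop (𝓝 0) := by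
      refine squeeze_zero_norm' ?_ tendsto_inv_atTop_zero
      filter_upwards [eventually_ge_atTop 1] with z hz
      have hz0 : 0 < z := by linarith
      have h1 : 1 ≤ z ^ n * ps p z := (one_le_pow₀ hz).trans (hW z hz)
      rw [Real.norm_eq_abs, abs_of_pos (by positivity), one_div]
      exact div_le_self (by positivity) h1
    have := l3.add (((l1.add l2).add (hT.const_mul (c n))).const_mul (θ - 1))
    simp only [mul_zero, add_zero] at this
    refine this.congr' ?_
    filter_upwards [eventually_ge_atTop 1] with z hz
    have hz0 : 0 < z := by linarith
    have := hP1 z hz0.le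
    unfold Hs
    rw [ps_split cPB n z, ps_split dPB n z, hcp, hdp]
    generalize ps (fun i => p i * eK θ (i + n)) z = Q1 at *
    field_simp
    ring


lemma ode_unique (θ a : ℝ) (ha : 0 < a) (y y1 : ℝ → ℝ) (h1 : ∀ t, a ≤ t → HasDerivAt y (y1 t) t)
    (h2 : ∀ t, a ≤ t → HasDerivAt y1 ((1 - 2 / t) * y1 t + θ / t * y t) t) (e1 : y a = 0) (e2 : y1 a = 0) :
    ∀ t, a ≤ t → y t = 0 := by
  set K := 3 + |θ| / a with hK
  have hD : ∀ t, a ≤ t → HasDerivAt (fun t => (y t ^ 2 + y1 t ^ 2) * exp (-(K * t)))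
      ((2 * y t * y1 t + 2 * y1 t * ((1 - 2 / t) * y1 t + θ / t * y t)) * exp (-(K * t)) + (y t ^ 2 + y1 t ^ 2) * (exp (-(K * t)) * (-K))) t := by
    intro t ht
    have h3 : HasDerivAt (fun t => exp (-(K * t))) (exp (-(K * t)) * (-K)) t := by
      have := (((hasDerivAt_id t).const_mul K).neg).exp
      simpa using this
    refine ((((h1 t ht).pow 2).add ((h2 t ht).pow 2)).mul h3).congr_deriv ?_
    simp
  have anti : AntitoneOn (fun t => (y t ^ 2 + y1 t ^ 2) * exp (-(K * t))) (Ici a) := by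
    apply antitoneOn_of_deriv_nonpos (convex_Ici _)
    · exact fun t ht => (hD t ht).continuousAt.continuousWithinAt
    · exact fun t ht => (hD t (by rw [interior_Ici] at ht; exact le_of_lt ht)).differentiableAt.differentiableWithinAt
    · intro t ht
      rw [interior_Ici] at ht
      have hta : a ≤ t := le_of_lt ht
      have ht0 : 0 < t := ha.trans_le hta
      rw [(hD t hta).deriv]
      have hθ : |θ / t| ≤ |θ| / a := by rw [abs_div, abs_of_pos ht0]; gcongr
      have h5 : 2 * y t * y1 t * (1 + θ / t) ≤ (1 + |θ| / a) * (y t ^ 2 + y1 t ^ 2) := by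
        have p1 : |2 * y t * y1 t| ≤ y t ^ 2 + y1 t ^ 2 := by
          rw [abs_le]; constructor <;> nlinarith [sq_nonneg (y t + y1 t), sq_nonneg (y t - y1 t)]
        have p2 : |1 + θ / t| ≤ 1 + |θ| / a := (abs_add_le _ _).trans (by rw [abs_one]; linarith)
        calc _ ≤ |2 * y t * y1 t * (1 + θ / t)| := le_abs_self _
          _ = |1 + θ / t| * |2 * y t * y1 t| := by rw [abs_mul, mul_comm]
          _ ≤ _ := by gcongr
      have h6 : 0 ≤ 2 / t * y1 t ^ 2 := by positivity
      have h7 : 2 * y t * y1 t + 2 * y1 t * ((1 - 2 / t) * y1 t + θ / t * y t) ≤ K * (y t ^ 2 + y1 t ^ 2) := by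
        rw [hK]; nlinarith [sq_nonneg (y t), sq_nonneg (y1 t)]
      have h8 := mul_le_mul_of_nonneg_right h7 (exp_pos (-(K * t))).le
      linarith
  intro t ht
  have := anti self_mem_Ici (mem_Ici.2 ht) ht
  simp only [e1, e2] at this
  have h9 : y t ^ 2 + y1 t ^ 2 ≤ 0 := by
    by_contra h
    push Not at h
    have := mul_pos h (exp_pos (-(K * t)))
    norm_num at *
    linarith
  have : y t ^ 2 = 0 := by nlinarith [sq_nonneg (y t), sq_nonneg (y1 t)]
  exact pow_eq_zero_iff (two_ne_zero) |>.1 this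

lemma ps_zero (a : ℕ → ℝ) : ps a 0 = a 0 := by
  rw [ps, tsum_eq_single 0]
  · simp
  · intro i hi; simp [hi]

lemma wronsk {A ρ A' ρ' θ : ℝ} {c d : ℕ → ℝ} (hc : PB A ρ c) (hd : PB A' ρ' d) (c0 : c 0 = 1)
    (hr : ∀ i : ℕ, ((i:ℝ) + 1) * (i + 2) * c (i+1) = (θ + i) * c i)
    (hr' : ∀ i : ℕ, ((i:ℝ) + 1) * (i + 2) * d (i+1) = (θ + i) * d i + c i - (2 * i + 3) * c (i + 1))
    (z : ℝ) (hz : 0 < z) : ps c z * Hs1 θ c d z - ps (psd c) z * Hs θ c d z ≠ 0 := by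
  set f : ℝ → ℝ := fun z => z ^ 2 * exp (-z) * (ps c z * Hs1 θ c d z - ps (psd c) z * Hs θ c d z) with hf
  have fd : ∀ t ∈ Ioi (0:ℝ), HasDerivAt f 0 t := by
    intro t ht
    have ht0 : t ≠ 0 := ne_of_gt ht
    have h3 : HasDerivAt (fun s : ℝ => exp (-s)) (-exp (-t)) t := by
      simpa using (hasDerivAt_neg t).exp
    have := (((hasDerivAt_pow 2 t).mul h3).mul (((hc.hasDeriv t).mul (Hs1_deriv hc hd c0 hr hr' t ht0)).sub
      ((psM1_deriv hc hr t ht0).mul (Hs_deriv (θ := θ) hc hd t ht0))))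
    refine this.congr_deriv ?_
    simp
    field_simp
    ring
  have hconst : ∀ t ∈ Ioi (0:ℝ), f t = f z := fun t ht =>
    isOpen_Ioi.is_const_of_deriv_eq_zero isPreconnected_Ioi
      (fun s hs => (fd s hs).differentiableAt.differentiableWithinAt) (fun s hs => (fd s hs).deriv) ht hz
  set F : ℝ → ℝ := fun z => exp (-z) * (ps c z * (-1 + (θ - 1) * (z * ps c z + z * (z * log z) * ps (psd c) z + z ^ 2 * ps (psd d) z))
    - ps (psd c) z * (z + (θ - 1) * (z * (z * log z) * ps c z + z ^ 2 * ps d z))) with hF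
  have cont : ∀ {B σ : ℝ} {x : ℕ → ℝ}, PB B σ x → Continuous (ps x) := fun h =>
    continuous_iff_continuousAt.2 fun t => (h.hasDeriv t).continuousAt
  have Fc : Continuous F := by
    have h1 := cont hc
    have h2 := cont hc.psd
    have h3 := cont hd
    have h4 := cont hd.psd
    have h5 := Real.continuous_mul_log
    exact (by fun_prop : Continuous fun z : ℝ => exp (-z)).mul
      ((h1.mul (continuous_const.add (continuous_const.mul (((continuous_id.mul h1).add ((continuous_id.mul h5).mul h2)).add
        ((continuous_pow 2).mul h4))))).sub (h2.mul (continuous_id.add (continuous_const.mul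
        (((continuous_id.mul h5).mul h1).add ((continuous_pow 2).mul h3))))))
  have F0 : F 0 = -1 := by simp [hF, ps_zero, c0]
  have hFf : ∀ t ∈ Ioi (0:ℝ), F t = f z := by
    intro t ht
    rw [← hconst t ht]
    have ht0 : t ≠ 0 := ne_of_gt ht
    simp only [hf, hF, Hs1, Hs]
    field_simp
  have l1 : Tendsto F (𝓝[>] 0) (𝓝 (-1)) := by
    rw [← F0]; exact Fc.continuousAt.tendsto.mono_left nhdsWithin_le_nhds
  have l2 : Tendsto F (𝓝[>] 0) (𝓝 (f z)) := by
    refine tendsto_const_nhds.congr' ?_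
    filter_upwards [self_mem_nhdsWithin] with t ht
    exact (hFf t ht).symm
  have := tendsto_nhds_unique l1 l2
  intro h0
  simp only [hf, h0, mul_zero] at this
  norm_num at this

noncomputable def U1 (θ : ℝ) (w v : ℝ → ℝ) (z : ℝ) : ℝ := z ^ (-θ) * (v z - θ * w z / z)

lemma U_deriv (θ : ℝ) (w v : ℝ → ℝ) (t : ℝ) (ht : 0 < t) (h : HasDerivAt w (v t) t) :
    HasDerivAt (fun z => z ^ (-θ) * w z) (U1 θ w v t) t := by
  refine ((Real.hasDerivAt_rpow_const (p := -θ) (Or.inl ht.ne')).mul h).congr_deriv ?_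
  unfold U1
  rw [Real.rpow_sub_one ht.ne']
  field_simp
  ring

lemma U1_deriv (θ : ℝ) (w v : ℝ → ℝ) (t x : ℝ) (ht : 0 < t) (h : HasDerivAt w (v t) t) (h' : HasDerivAt v x t) :
    HasDerivAt (U1 θ w v) (t ^ (-θ) * (x - 2 * θ / t * v t + θ * (θ + 1) / t ^ 2 * w t)) t := by
  have h2 : HasDerivAt (fun z => v z - θ * w z / z) (x - (θ * v t * t - θ * w t * 1) / t ^ 2) t :=
    h'.sub ((h.const_mul θ).div (hasDerivAt_id t) ht.ne')
  refine ((Real.hasDerivAt_rpow_const (p := -θ) (Or.inl ht.ne')).mul h2).congr_deriv ?_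
  rw [Real.rpow_sub_one ht.ne']
  field_simp
  ring

lemma kappa_exists (n : ℕ) (θ s a : ℝ) (ha : 0 < a) (hτ : 0 < θ + n) (hτ1 : θ + n < 1) (hs : 0 < s) (hx : ∀ j : ℕ, s ≤ |θ + j|)
    (w v : ℝ → ℝ) (hw : IsSol a θ 0 w v) :
    ∃ κ, κ ≠ 0 ∧ ∀ z, a ≤ z → Hs θ (kummerCoeff θ) (dK θ) z = κ * (z ^ (-θ) * w z) := by
  obtain ⟨W, hW, ⟨k, hk, lM⟩, lH⟩ := kum_asym n θ s hτ hτ1 hs hx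
  have hn0 : (0:ℝ) ≤ n := Nat.cast_nonneg n
  have hθ : |θ| ≤ n + 1 := by rw [abs_le]; constructor <;> linarith
  have hθ1 : 1 ≤ θ + n + 1 := by linarith
  have hne : ∀ m : ℕ, θ ≠ -m := fun m h => by
    have := hx m
    rw [h] at this; simp at this; linarith
  have cPB : PB 1 (n+1) (kummerCoeff θ) := kum_PB n θ hθ
  have dPB := dK_PB n θ s hθ hθ1 hs hx
  have hr := kum_succ θ
  have hr' := dK_succ θ hne
  have c0 := kum_zero θ
  set c := kummerCoeff θ
  set d := dK θ
  have lU : Tendsto (fun z => z ^ (-θ) * w z / W z) atTop (𝓝 0) := by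
    have l1 : Tendsto (fun z => z ^ (-(θ + n)) * |w z|) atTop (𝓝 (0 * |1|)) :=
      (tendsto_rpow_neg_atTop hτ).mul hw.lim.abs
    rw [zero_mul] at l1
    refine squeeze_zero_norm' ?_ l1
    filter_upwards [eventually_ge_atTop 1] with z hz
    have hz0 : 0 < z := by linarith
    have hW0 : 0 < W z := (pow_pos hz0 n).trans_le (hW z hz)
    rw [Real.norm_eq_abs, abs_div, abs_of_pos hW0, abs_mul, abs_of_pos (by positivity), div_le_iff₀ hW0, neg_add, Real.rpow_add hz0,
      Real.rpow_neg hz0.le (n:ℝ), Real.rpow_natCast]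
    have h1 : 1 ≤ (z ^ n)⁻¹ * W z := by
      rw [inv_mul_eq_div, le_div_iff₀ (by positivity)]; linarith [hW z hz]
    calc _ = z ^ (-θ) * |w z| * 1 := by ring
      _ ≤ z ^ (-θ) * |w z| * ((z ^ n)⁻¹ * W z) := by gcongr
      _ = _ := by ring
  set α := a ^ (-θ) * w a * ps (psd c) a - U1 θ w v a * ps c a with hα
  set β := ps c a * Hs1 θ c d a - ps (psd c) a * Hs θ c d a with hβ
  set γ := Hs θ c d a * U1 θ w v a - Hs1 θ c d a * (a ^ (-θ) * w a) with hγ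
  have hβ0 : β ≠ 0 := wronsk cPB dPB c0 hr hr' a ha
  have hzero : ∀ t, a ≤ t → α * Hs θ c d t + β * (t ^ (-θ) * w t) + γ * ps c t = 0 := by
    refine ode_unique θ a ha _ (fun t => α * Hs1 θ c d t + β * U1 θ w v t + γ * ps (psd c) t) ?_ ?_ ?_ ?_
    · intro t ht
      have ht0 : 0 < t := ha.trans_le ht
      exact (((Hs_deriv cPB dPB t ht0.ne').const_mul α).add ((U_deriv θ w v t ht0 (hw.dw t ht)).const_mul β)).add
        ((cPB.hasDeriv t).const_mul γ)
    · intro t ht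
      have ht0 : 0 < t := ha.trans_le ht
      refine ((((Hs1_deriv cPB dPB c0 hr hr' t ht0.ne').const_mul α).add ((U1_deriv θ w v t _ ht0 (hw.dw t ht) (hw.dv t ht)).const_mul β)).add
        ((psM1_deriv cPB hr t ht0.ne').const_mul γ)).congr_deriv ?_
      simp only [cT, rT, U1]
      field_simp
      ring
    · simp only [hα, hβ, hγ]; ring
    · simp only [hα, hβ, hγ]; ring
  have hγ0 : γ = 0 := by
    have l := ((lH.const_mul α).add (lU.const_mul β)).add (lM.const_mul γ)
    simp only [mul_zero, zero_add] at l
    have l0 : Tendsto (fun z => α * (Hs θ c d z / W z) + β * (z ^ (-θ) * w z / W z) + γ * (ps c z / W z)) atTop (𝓝 0) := by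
      refine tendsto_const_nhds.congr' ?_
      filter_upwards [eventually_ge_atTop a] with z hz
      have := hzero z hz
      calc (0:ℝ) = (α * Hs θ c d z + β * (z ^ (-θ) * w z) + γ * ps c z) / W z := by rw [this, zero_div]
        _ = _ := by ring
    have := tendsto_nhds_unique l l0
    exact (mul_eq_zero.1 this).resolve_right hk
  have hα0 : α ≠ 0 := by
    intro h
    obtain ⟨Y, hY, hY'⟩ := ((hw.lim.eventually (lt_mem_nhds (by norm_num : (0:ℝ) < 1))).and (eventually_ge_atTop a)).exists
    have := hzero Y hY'
    have hY0 : 0 < Y := ha.trans_le hY'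
    rw [h, hγ0] at this
    have h2 : Y ^ (-θ) * w Y ≠ 0 := by positivity
    simp only [zero_mul, zero_add, add_zero] at this
    exact (mul_ne_zero hβ0 h2) this
  refine ⟨-β / α, div_ne_zero (neg_ne_zero.2 hβ0) hα0, fun z hz => ?_⟩
  have := hzero z hz
  rw [hγ0] at this
  field_simp
  linear_combination this


lemma kappa_bound (n : ℕ) (a K : ℝ) (ha : 0 < a) (hK : 0 < K) : ∃ Q, 0 < Q ∧ ∀ θ Lg κ : ℝ, ∀ w v : ℝ → ℝ, 0 < θ + n → θ + n < 1 → 1 ≤ Lg →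
    (∀ j : ℕ, 1 / (2 * Lg) ≤ |θ + j|) → (∀ t, a ≤ t → |w t - 1| ≤ K / t) →
    (∀ z, a ≤ z → Hs θ (kummerCoeff θ) (dK θ) z = κ * (z ^ (-θ) * w z)) → |κ| ≤ Q * Lg := by
  set R := 1 + a + 2 * K with hR
  set E1 := exp ((n + 1) * R)
  set E2 := exp (2 * (n + 1) * R)
  have hR1 : 1 ≤ R := by rw [hR]; linarith
  have hR0 : 0 < R := by linarith
  have hlog := Real.log_nonneg hR1
  refine ⟨2 * R * (1 + (n + 2) * (log R * E1 + (4 * n + 8) * E2)), by positivity, ?_⟩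
  intro θ Lg κ w v hτ hτ1 hL hx hw hH
  have hn0 : (0:ℝ) ≤ n := Nat.cast_nonneg n
  have hθ : |θ| ≤ n + 1 := by rw [abs_le]; constructor <;> linarith
  have hθ1 : 1 ≤ θ + n + 1 := by linarith
  have cPB : PB 1 (n+1) (kummerCoeff θ) := kum_PB n θ hθ
  have dPB := dK_PB n θ (1 / (2 * Lg)) hθ hθ1 (by positivity) hx
  have b1 := cPB.bound R
  have b2 := dPB.bound R
  rw [abs_of_pos hR0, one_mul] at b1
  rw [abs_of_pos hR0] at b2
  have hHb : |Hs θ (kummerCoeff θ) (dK θ) R| ≤ (1 + (n + 2) * (log R * E1 + (4 * n + 8) * E2)) * Lg := by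
    unfold Hs
    have t1 : |1 / R| ≤ 1 := by rw [abs_of_pos (by positivity), div_le_one hR0]; exact hR1
    have t2 : |θ - 1| ≤ n + 2 := by rw [abs_le]; constructor <;> linarith
    have t3 : |log R * ps (kummerCoeff θ) R| ≤ log R * E1 := by
      rw [abs_mul, abs_of_nonneg hlog]; gcongr
    have t4 : |ps (dK θ) R| ≤ (4 * n + 8) * E2 * Lg := by
      refine b2.trans ?_
      have : 2 * (n:ℝ) + 6 + (n + 1) / (1 / (2 * Lg)) ≤ (4 * n + 8) * Lg := by
        field_simp; nlinarith
      calc _ ≤ ((4 * n + 8) * Lg) * E2 := by gcongr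
        _ = _ := by ring
    have hE1 : 0 < E1 := exp_pos _
    have hE2 : 0 < E2 := exp_pos _
    calc _ ≤ |1 / R| + |θ - 1| * (|log R * ps (kummerCoeff θ) R| + |ps (dK θ) R|) := by
          refine (abs_add_le _ _).trans ?_
          rw [abs_mul]
          gcongr
          exact abs_add_le _ _
      _ ≤ 1 + (n + 2) * (log R * E1 + (4 * n + 8) * E2 * Lg) := by gcongr
      _ ≤ 1 * Lg + (n + 2) * (log R * E1 * Lg + (4 * n + 8) * E2 * Lg) := by
          have : log R * E1 ≤ log R * E1 * Lg := le_mul_of_one_le_right (by positivity) hL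
          gcongr
          linarith
      _ = _ := by ring
  have hwR : 1 / 2 ≤ |w R| := by
    have h1 := hw R (by rw [hR]; linarith)
    have h2 : K / R ≤ 1 / 2 := by rw [div_le_div_iff₀ hR0 two_pos, hR]; linarith
    have := abs_le.1 (h1.trans h2)
    exact le_trans (by linarith) (le_abs_self _)
  have hRθ : 1 ≤ R * R ^ (-θ) := by
    rw [← Real.rpow_one_add' hR0.le (by linarith)]
    exact Real.one_le_rpow hR1 (by linarith)
  have h3 := hH R (by rw [hR]; linarith)
  rw [h3, abs_mul, abs_mul, abs_of_pos (by positivity : 0 < R ^ (-θ))] at hHb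
  have hp : 0 < R ^ (-θ) := by positivity
  calc |κ| ≤ |κ| * ((R * R ^ (-θ)) * (2 * |w R|)) := by
        have : 1 ≤ (R * R ^ (-θ)) * (2 * |w R|) := one_le_mul_of_one_le_of_one_le hRθ (by linarith)
        exact le_mul_of_one_le_right (abs_nonneg _) this
    _ = 2 * R * (|κ| * (R ^ (-θ) * |w R|)) := by ring
    _ ≤ 2 * R * ((1 + (n + 2) * (log R * E1 + (4 * n + 8) * E2)) * Lg) := by gcongr
    _ = _ := by ring

lemma sol_smooth (a θ b : ℝ) (ha : 0 < a) (hb : 0 ≤ b) (w v : ℝ → ℝ) (h : IsSol a θ b w v) (k : ℕ) :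
    ContDiffOn ℝ k w (Ioi a) ∧ ContDiffOn ℝ k v (Ioi a) := by
  have hpos : ∀ z ∈ Ioi a, z ≠ 0 := fun z hz => (ha.trans hz).ne'
  have hbz : ∀ z ∈ Ioi a, b + 2 * z ≠ 0 := fun z hz => by
    have : 0 < z := ha.trans hz
    positivity
  induction k with
  | zero =>
    simp only [Nat.cast_zero, contDiffOn_zero]
    exact ⟨fun t ht => (h.dw t (le_of_lt ht)).continuousAt.continuousWithinAt, fun t ht => (h.dv t (le_of_lt ht)).continuousAt.continuousWithinAt⟩
  | succ k ih =>
    have hc : ContDiffOn ℝ k (cT θ b) (Ioi a) := by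
      unfold cT
      refine (contDiffOn_const.div contDiffOn_id hpos).sub (contDiffOn_const.div (contDiffOn_id.mul (contDiffOn_const.add (contDiffOn_const.mul contDiffOn_id))) ?_)
      exact fun z hz => mul_ne_zero (hpos z hz) (hbz z hz)
    have hr : ContDiffOn ℝ k (rT θ b) (Ioi a) := by
      unfold rT
      have h1 : ContDiffOn ℝ k (fun z : ℝ => b + 2 * z) (Ioi a) := contDiffOn_const.add (contDiffOn_const.mul contDiffOn_id)
      refine ((contDiffOn_const.div (contDiffOn_id.pow 2) ?_).add (contDiffOn_const.div (contDiffOn_id.mul (h1.pow 2)) ?_)).add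
        (contDiffOn_const.div ((contDiffOn_id.pow 2).mul h1) ?_)
      · exact fun z hz => pow_ne_zero 2 (hpos z hz)
      · exact fun z hz => mul_ne_zero (hpos z hz) (pow_ne_zero 2 (hbz z hz))
      · exact fun z hz => mul_ne_zero (pow_ne_zero 2 (hpos z hz)) (hbz z hz)
    push_cast
    rw [contDiffOn_succ_iff_deriv_of_isOpen isOpen_Ioi, contDiffOn_succ_iff_deriv_of_isOpen isOpen_Ioi]
    refine ⟨⟨fun t ht => (h.dw t (le_of_lt ht)).differentiableAt.differentiableWithinAt, by simp, ?_⟩,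
      ⟨fun t ht => (h.dv t (le_of_lt ht)).differentiableAt.differentiableWithinAt, by simp, ?_⟩⟩
    · exact ih.2.congr fun t ht => (h.dw t (le_of_lt ht)).deriv
    · exact (ih.2.sub ((hc.mul ih.2).add (hr.mul ih.1))).congr fun t ht => (h.dv t (le_of_lt ht)).deriv

lemma derivs_of (a : ℝ) (f f1 f2 : ℝ → ℝ) (h1 : ∀ t, a < t → HasDerivAt f (f1 t) t) (h2 : ∀ t, a < t → HasDerivAt f1 (f2 t) t)
    (z : ℝ) (hz : a < z) : deriv f z = f1 z ∧ deriv (deriv f) z = f2 z := by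
  refine ⟨(h1 z hz).deriv, ?_⟩
  have : deriv f =ᶠ[𝓝 z] f1 := by
    filter_upwards [isOpen_Ioi.mem_nhds hz] with t ht
    exact (h1 t ht).deriv
  rw [this.deriv_eq, (h2 z hz).deriv]

lemma jap_bd (z z0 θ δ : ℝ) (hz0 : 0 < z0) (hz : z0 ≤ z) (hθ : θ ≤ 1) (hδ : 0 < δ) :
    jap z ^ (θ - δ) * z ^ (-θ) ≤ 1 + 1 / z0 := by
  have hzp : 0 < z := hz0.trans_le hz
  have j1 : 1 ≤ jap z := by
    unfold jap
    rw [Real.one_le_sqrt]; nlinarith [sq_nonneg z]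
  have jz : z ≤ jap z := by
    unfold jap
    apply Real.le_sqrt_of_sq_le; linarith
  have ju : jap z ≤ 1 + z := by
    unfold jap
    rw [Real.sqrt_le_left (by linarith)]; nlinarith
  have j0 : 0 < jap z := by linarith
  have hr : 1 ≤ jap z / z := by rw [le_div_iff₀ hzp]; linarith
  calc _ ≤ jap z ^ θ * z ^ (-θ) := by
        gcongr
        linarith
    _ = (jap z / z) ^ θ := by rw [Real.div_rpow j0.le hzp.le, Real.rpow_neg hzp.le]; rfl
    _ ≤ (jap z / z) ^ (1:ℝ) := Real.rpow_le_rpow_of_exponent_le hr hθ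
    _ = jap z / z := Real.rpow_one _
    _ ≤ (1 + z) / z := by gcongr
    _ = 1 / z + 1 := by field_simp
    _ ≤ 1 / z0 + 1 := by gcongr
    _ = _ := by ring


set_option maxHeartbeats 4000000 in
lemma core (n : ℕ) (δ : ℝ) (hδ : 0 < δ) (C0 : ℝ) (z0 : ℝ) (hz0 : 0 < z0)
    (w0 v0 : ℝ → ℝ) (Z : Finset ℝ) (hsol : ∀ a, 0 < a → IsSol a (1 - (n:ℝ)) 0 w0 v0)
    (hZ : ∀ t, 0 < t → (w0 t = 0 ↔ t ∈ Z)) (hv : ∀ ξ ∈ Z, v0 ξ ≠ 0) (hZ0 : ∀ ξ ∈ Z, z0 < ξ) :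
    ∃ bstar : ℝ, bstar ∈ Set.Ioo (0:ℝ) 1 ∧ ∃ C' : ℝ, 0 < C' ∧
        ∀ b : ℝ, 0 < b → b ≤ bstar →
          ∀ αbar : ℝ, |αbar| ≤ C0 / (Real.log b) ^ 2 →
            ∀ θ : ℝ, θ = 1 - (n : ℝ) + 1 / Real.log b + αbar → 
              ∃ q : ℝ → ℝ,
                ContDiffOn ℝ (⊤ : ℕ∞) q (Set.Ici z0) ∧
                (∀ z ∈ Set.Ici z0,
                  z * deriv (deriv q) z + (2 - z) * deriv q z - θ * q z
                      - (2 * b / (b + 2 * z)) * deriv q z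
                      + (4 * b / (b + 2 * z) ^ 2) * q z = 0) ∧
                (∀ z ∈ Set.Ici z0,
                  jap z ^ (θ - δ)
                      * (|q z - Real.Gamma θ * hKum θ z|
                          + z * |deriv (fun w => q w - Real.Gamma θ * hKum θ w) z|
                          + z ^ 2 * |deriv (deriv
                              (fun w => q w - Real.Gamma θ * hKum θ w)) z|)
                    ≤ C' * b * |Real.log b|) ∧
                  {z : ℝ | z0 ≤ z ∧ q z = 0}.Finite ∧
                  {z : ℝ | z0 ≤ z ∧ q z = 0}.ncard = Z.card := by
  have hn0 : (0:ℝ) ≤ n := Nat.cast_nonneg n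
  set a := z0 / 2 with ha'
  have ha : 0 < a := by positivity
  have haz : a < z0 := by rw [ha']; linarith
  obtain ⟨K1, hK1, sb⟩ := sol_bounds a (n+1) ha (by linarith)
  obtain ⟨K2, hK2, sd⟩ := sol_diff a (n+1) ha (by linarith)
  obtain ⟨Q, hQ, kb⟩ := kappa_bound n a K1 ha hK1
  have hs0 := hsol a ha
  obtain ⟨η, hη, zc⟩ := zero_count z0 w0 v0 Z (fun t ht => hZ t (hz0.trans_le ht)) hZ0
    (fun t ht => hs0.dw t (haz.le.trans ht)) (fun t ht => (hs0.dv t (haz.le.trans ht)).continuousAt) hv hs0.lim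
  set D := 1 + 1 / z0 ^ 2 with hD
  have hDpos : 0 < D := by positivity
  set L0 := 4 + 2 * |C0| + 3 * K2 * D / η with hL0
  have hL0p : 0 < 3 * K2 * D / η := by positivity
  have hC0a := abs_nonneg C0
  set Θ : ℝ := n + 1 with hΘ
  have hΘp : 0 < Θ := by positivity
  set S := 2 + Θ + Θ * (Θ + 1) + (1 + 2 * Θ) / z0 with hS
  refine ⟨min (exp (-L0)) (min a (η / (2 * K2 * D))), ⟨by positivity, ?_⟩, Q * K2 * S * (1 + 1 / z0), by positivity, ?_⟩
  · refine (min_le_left _ _).trans_lt ?_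
    rw [Real.exp_lt_one_iff]; linarith
  intro b hb hbs αbar hα θ hθ
  have hb1 : b ≤ exp (-L0) := hbs.trans (min_le_left _ _)
  have hb2 : b ≤ a := hbs.trans ((min_le_right _ _).trans (min_le_left _ _))
  have hb3 : b ≤ η / (2 * K2 * D) := hbs.trans ((min_le_right _ _).trans (min_le_right _ _))
  obtain ⟨Lg, hLg⟩ : ∃ Lg, Lg = -log b := ⟨_, rfl⟩
  have hlb : log b = -Lg := by linarith
  have hLL : L0 ≤ Lg := by
    have := Real.log_le_log hb hb1
    rw [Real.log_exp] at this; linarith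
  have hL4 : 4 ≤ Lg := by linarith
  have hLp : 0 < Lg := by linarith
  have habs : |log b| = Lg := by rw [hlb, abs_neg, abs_of_pos hLp]
  have hα2 : |αbar| ≤ 1 / (2 * Lg) := by
    refine hα.trans ?_
    rw [hlb, neg_sq, div_le_div_iff₀ (by positivity) (by positivity)]
    have : C0 ≤ |C0| := le_abs_self _
    nlinarith
  have hθ2 : θ = 1 - n - 1 / Lg + αbar := by rw [hθ, hlb, div_neg]; ring
  have e1 : 1 / (2 * Lg) = 1 / Lg / 2 := by field_simp
  have e2 : 1 / Lg ≤ 1 / 4 := one_div_le_one_div_of_le (by norm_num) hL4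
  have e3 : 0 < 1 / Lg := by positivity
  rw [e1, abs_le] at hα2
  have d1 : 1 / Lg / 2 ≤ (1 - n) - θ := by linarith
  have d2 : (1 - n) - θ ≤ 3 / 2 * (1 / Lg) := by linarith
  have hτ : 0 < θ + n := by linarith
  have hτ1 : θ + n < 1 := by linarith
  have hx : ∀ j : ℕ, 1 / (2 * Lg) ≤ |θ + j| := by
    intro j
    rw [e1]
    rcases Nat.lt_or_ge j n with hj | hj
    · have : (j:ℝ) + 1 ≤ n := by exact_mod_cast hj
      rw [abs_of_neg (by linarith)]; linarith
    · have : (n:ℝ) ≤ j := by exact_mod_cast hj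
      rw [abs_of_pos (by linarith)]; linarith
  have hθa : |θ| ≤ Θ := by rw [abs_le, hΘ]; constructor <;> linarith
  have hθ0a : |1 - (n:ℝ)| ≤ Θ := by rw [abs_le, hΘ]; constructor <;> linarith
  obtain ⟨w, v, hw⟩ := sol_exists a θ b ha hb.le hb2
  obtain ⟨u, y, hu⟩ := sol_exists a θ 0 ha le_rfl ha.le
  obtain ⟨κ, hκ, hH⟩ := kappa_exists n θ (1 / (2 * Lg)) a ha hτ hτ1 (by positivity) hx u y hu
  have hκb : |κ| ≤ Q * Lg := kb θ Lg κ u y hτ hτ1 (by linarith) hx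
    (fun t ht => (sb θ 0 u y hθa le_rfl ha.le hu t ht).2.1) hH
  have hGH : ∀ z, Real.Gamma θ * hKum θ z = Hs θ (kummerCoeff θ) (dK θ) z :=
    hKum_eq n θ (1 / (2 * Lg)) hθa (by linarith) (by positivity) hx (by linarith)
  set q : ℝ → ℝ := fun z => κ * (z ^ (-θ) * w z) with hq
  have hqd := derivs_of a q (fun z => κ * U1 θ w v z)
    (fun t => κ * (t ^ (-θ) * ((v t - (cT θ b t * v t + rT θ b t * w t)) - 2 * θ / t * v t + θ * (θ + 1) / t ^ 2 * w t)))
    (fun t ht => (U_deriv θ w v t (ha.trans ht) (hw.dw t ht.le)).const_mul κ)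
    (fun t ht => (U1_deriv θ w v t _ (ha.trans ht) (hw.dw t ht.le) (hw.dv t ht.le)).const_mul κ)
  refine ⟨q, ?_, ?_, ?_, ?_⟩
  · rw [contDiffOn_infty]
    intro k
    have h1 := (sol_smooth a θ b ha hb.le w v hw k).1
    have h2 : ContDiffOn ℝ k (fun z : ℝ => z ^ (-θ)) (Ioi a) := fun z hz =>
      (Real.contDiffAt_rpow_const_of_ne (ha.trans hz).ne').contDiffWithinAt
    exact (contDiffOn_const.mul (h2.mul h1)).mono (fun z hz => haz.trans_le hz)
  · intro z hz
    have hz' : z0 ≤ z := hz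
    have hzp : 0 < z := hz0.trans_le hz'
    obtain ⟨r1, r2⟩ := hqd z (haz.trans_le hz')
    rw [r1, r2]
    simp only [hq, U1, cT, rT]
    have : b + 2 * z ≠ 0 := by positivity
    field_simp
    ring
  · intro z hz
    have hz' : z0 ≤ z := hz
    have hzp : 0 < z := hz0.trans_le hz'
    have haz' : a < z := haz.trans_le hz'
    set g : ℝ → ℝ := fun z => κ * (z ^ (-θ) * (w z - u z)) with hg
    have hgd := derivs_of a g (fun z => κ * U1 θ (fun z => w z - u z) (fun z => v z - y z) z)
      (fun t => κ * (t ^ (-θ) * (((v t - (cT θ b t * v t + rT θ b t * w t)) - (y t - (cT θ 0 t * y t + rT θ 0 t * u t))) - 2 * θ / t * (v t - y t) + θ * (θ + 1) / t ^ 2 * (w t - u t))))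
      (fun t ht => (U_deriv θ (fun z => w z - u z) (fun z => v z - y z) t (ha.trans ht) ((hw.dw t ht.le).sub (hu.dw t ht.le))).const_mul κ)
      (fun t ht => (U1_deriv θ (fun z => w z - u z) (fun z => v z - y z) t _ (ha.trans ht) ((hw.dw t ht.le).sub (hu.dw t ht.le)) ((hw.dv t ht.le).sub (hu.dv t ht.le))).const_mul κ)
    have heq : ∀ t, a < t → q t - Real.Gamma θ * hKum θ t = g t := by
      intro t ht
      rw [hGH, hH t ht.le]; simp only [hq, hg]; ring
    have hev : (fun t => q t - Real.Gamma θ * hKum θ t) =ᶠ[𝓝 z] g := by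
      filter_upwards [isOpen_Ioi.mem_nhds haz'] with t ht using heq t ht
    rw [hev.deriv_eq, hev.deriv.deriv_eq, heq z haz', (hgd z haz').1, (hgd z haz').2]
    obtain ⟨b1, b2, b3⟩ := sd θ θ b w v u y hθa hθa hb.le hb2 hw hu z haz'.le
    rw [sub_self, abs_zero, zero_add] at b1 b2 b3
    generalize (v z - (cT θ b z * v z + rT θ b z * w z)) - (y z - (cT θ 0 z * y z + rT θ 0 z * u z)) = dx at *
    simp only [hg, U1]
    generalize w z - u z = dw at *
    generalize v z - y z = dv at *
    have hzt : 0 < z ^ (-θ) := by positivity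
    have hθ1a : |θ + 1| ≤ Θ + 1 := (abs_add_le _ _).trans (by rw [abs_one]; linarith)
    have m0 : |κ * (z ^ (-θ) * dw)| ≤ |κ| * z ^ (-θ) * (K2 * b) := by
      rw [abs_mul, abs_mul, abs_of_pos hzt, ← mul_assoc]; gcongr
    have m1 : z * |κ * (z ^ (-θ) * (dv - θ * dw / z))| ≤ |κ| * z ^ (-θ) * (K2 * b * (1 / z + Θ)) := by
      have : |dv - θ * dw / z| ≤ K2 * b / z ^ 2 + Θ * (K2 * b) / z := by
        refine (abs_sub _ _).trans ?_
        rw [abs_div, abs_mul, abs_of_pos hzp]; gcongr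
      rw [abs_mul, abs_mul, abs_of_pos hzt]
      calc _ ≤ z * (|κ| * (z ^ (-θ) * (K2 * b / z ^ 2 + Θ * (K2 * b) / z))) := by gcongr
        _ = _ := by field_simp
    have m2 : z ^ 2 * |κ * (z ^ (-θ) * (dx - 2 * θ / z * dv + θ * (θ + 1) / z ^ 2 * dw))| ≤ |κ| * z ^ (-θ) * (K2 * b * (1 + 2 * Θ / z + Θ * (Θ + 1))) := by
      have : |dx - 2 * θ / z * dv + θ * (θ + 1) / z ^ 2 * dw| ≤ K2 * b / z ^ 2 + 2 * Θ / z * (K2 * b / z ^ 2) + Θ * (Θ + 1) / z ^ 2 * (K2 * b) := by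
        refine (abs_add_le _ _).trans (add_le_add ((abs_sub _ _).trans (add_le_add b3 ?_)) ?_)
        · rw [abs_mul, abs_div, abs_mul, abs_of_pos hzp, abs_two]; gcongr
        · rw [abs_mul, abs_div, abs_mul, abs_of_pos (by positivity : 0 < z ^ 2)]; gcongr
      rw [abs_mul, abs_mul, abs_of_pos hzt]
      calc _ ≤ z ^ 2 * (|κ| * (z ^ (-θ) * (K2 * b / z ^ 2 + 2 * Θ / z * (K2 * b / z ^ 2) + Θ * (Θ + 1) / z ^ 2 * (K2 * b)))) := by gcongr
        _ = _ := by field_simp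
    have hj := jap_bd z z0 θ δ hz0 hz' (by linarith) hδ
    have hjp : 0 < jap z ^ (θ - δ) := by
      apply Real.rpow_pos_of_pos
      unfold jap; positivity
    have hsum : (1 / z + Θ) + (1 + 2 * Θ / z + Θ * (Θ + 1)) + 1 ≤ S := by
      have : 1 / z ≤ 1 / z0 := by gcongr
      have : 2 * Θ / z ≤ 2 * Θ / z0 := by gcongr
      rw [hS, add_div]; linarith
    rw [habs]
    have hSp : 0 < S := by positivity
    calc _ ≤ jap z ^ (θ - δ) * (|κ| * z ^ (-θ) * (K2 * b * ((1 / z + Θ) + (1 + 2 * Θ / z + Θ * (Θ + 1)) + 1))) := by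
          gcongr
          linarith
      _ ≤ jap z ^ (θ - δ) * (|κ| * z ^ (-θ) * (K2 * b * S)) := by gcongr
      _ = (jap z ^ (θ - δ) * z ^ (-θ)) * |κ| * (K2 * b * S) := by ring
      _ ≤ (1 + 1 / z0) * (Q * Lg) * (K2 * b * S) := by gcongr
      _ = _ := by ring
  · have hset : {z : ℝ | z0 ≤ z ∧ q z = 0} = {z : ℝ | z0 ≤ z ∧ w z = 0} := by
      ext z
      simp only [mem_setOf_eq]
      refine and_congr_right fun h => ?_
      have hzp : 0 < z := hz0.trans_le h
      have : z ^ (-θ) ≠ 0 := by positivity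
      simp only [hq, mul_eq_zero, hκ, this, false_or]
    rw [hset]
    have hsmall : K2 * (|θ - (1 - n)| + b) * D ≤ η := by
      have h1 : |θ - (1 - n)| ≤ 3 / 2 * (1 / Lg) := by rw [abs_le]; constructor <;> linarith
      have h2 : K2 * b * D ≤ η / 2 := by
        rw [le_div_iff₀ (by positivity)] at hb3
        linarith
      have h3 : K2 * (3 / 2 * (1 / Lg)) * D ≤ η / 2 := by
        have : 3 * K2 * D / η ≤ Lg := by linarith
        rw [div_le_iff₀ hη] at this
        field_simp
        linarith
      have h4 : K2 * |θ - (1 - n)| * D ≤ K2 * (3 / 2 * (1 / Lg)) * D := by gcongr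
      linarith
    have hnn : 0 ≤ K2 * (|θ - (1 - n)| + b) := by positivity
    refine zc w v (fun t ht => hw.dw t (haz.le.trans ht)) (fun t ht => ?_) (fun t ht => ?_)
    · have := (sd θ (1 - n) b w v w0 v0 hθa hθ0a hb.le hb2 hw hs0 t (haz.le.trans ht)).2.1
      have h1 : 1 ≤ D := by rw [hD]; have : 0 < 1 / z0 ^ 2 := by positivity
                            linarith
      exact this.trans ((le_mul_of_one_le_right hnn h1).trans hsmall)
    · have := (sd θ (1 - n) b w v w0 v0 hθa hθ0a hb.le hb2 hw hs0 t (haz.le.trans ht)).1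
      have h1 : 1 / t ^ 2 ≤ D := by
        have : 1 / t ^ 2 ≤ 1 / z0 ^ 2 := by gcongr
        rw [hD]; linarith
      refine this.trans (le_trans ?_ hsmall)
      rw [div_eq_mul_one_div]
      gcongr

lemma exists_below (Z : Finset ℝ) (hpos : ∀ ξ ∈ Z, 0 < ξ) : ∃ ζ1 : ℝ, 0 < ζ1 ∧ ∀ ξ ∈ Z, ζ1 < ξ := by
  have : ∀ᶠ ρ in 𝓝[>] (0:ℝ), ∀ ξ ∈ Z, ρ < ξ := by
    rw [Finset.eventually_all]
    exact fun ξ hξ => mem_nhdsWithin_of_mem_nhds (Iio_mem_nhds (hpos ξ hξ))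
  obtain ⟨ρ, h1, h2⟩ := (this.and self_mem_nhdsWithin).exists
  exact ⟨ρ, h2, h1⟩

end Helpers

theorem statement14 (n : ℕ) (δ : ℝ) (hδ : 0 < δ) (hδ' : δ < 1)
    (C0 : ℝ) (hC0 : 0 < C0) :
    ∃ C : ℝ, 0 < C ∧ ∃ ζstar : ℝ, 0 < ζstar ∧ ∀ ζ0 : ℝ, 0 < ζ0 → ζ0 ≤ ζstar →
      ∃ bstar : ℝ, bstar ∈ Set.Ioo (0:ℝ) 1 ∧ ∃ C' : ℝ, 0 < C' ∧
        ∀ b : ℝ, 0 < b → b ≤ bstar →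
          ∀ αbar : ℝ, |αbar| ≤ C0 / (Real.log b) ^ 2 →
            ∀ θ z0 : ℝ, θ = 1 - (n : ℝ) + 1 / Real.log b + αbar → z0 = ζ0 ^ 2 / 2 →
              ∃ q : ℝ → ℝ,
                ContDiffOn ℝ (⊤ : ℕ∞) q (Set.Ici z0) ∧
                (∀ z ∈ Set.Ici z0,
                  z * deriv (deriv q) z + (2 - z) * deriv q z - θ * q z
                      - (2 * b / (b + 2 * z)) * deriv q z
                      + (4 * b / (b + 2 * z) ^ 2) * q z = 0) ∧
                (∀ z ∈ Set.Ici z0,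
                  jap z ^ (θ - δ)
                      * (|q z - Real.Gamma θ * hKum θ z|
                          + z * |deriv (fun w => q w - Real.Gamma θ * hKum θ w) z|
                          + z ^ 2 * |deriv (deriv
                              (fun w => q w - Real.Gamma θ * hKum θ w)) z|)
                    ≤ C' * b * |Real.log b| ^ C) ∧
                ((n = 0 ∨ n = 1) → ∀ z ∈ Set.Ici z0, q z ≠ 0) ∧
                (2 ≤ n →
                  {z : ℝ | z0 ≤ z ∧ q z = 0}.Finite ∧
                  {z : ℝ | z0 ≤ z ∧ q z = 0}.ncard = n - 1) := by
  obtain ⟨w0, v0, Z, hcard, hpos, hsol, hZ, hv⟩ := lim_sol n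
  obtain ⟨ζ1, hζ1, hζ⟩ := exists_below Z hpos
  refine ⟨1, one_pos, min 1 ζ1, by positivity, fun ζ0 hζ0 hle => ?_⟩
  have h1 : ζ0 ≤ 1 := hle.trans (min_le_left _ _)
  have h2 : ζ0 ≤ ζ1 := hle.trans (min_le_right _ _)
  have hz0 : 0 < ζ0 ^ 2 / 2 := by positivity
  have hlt : ζ0 ^ 2 / 2 < ζ1 := by nlinarith
  obtain ⟨bstar, hbs, C', hC', H⟩ := core n δ hδ C0 (ζ0 ^ 2 / 2) hz0 w0 v0 Z hsol hZ hv
    (fun ξ hξ => hlt.trans (hζ ξ hξ))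
  refine ⟨bstar, hbs, C', hC', fun b hb hb' αbar hα θ z0 hθ hz => ?_⟩
  subst hz
  obtain ⟨q, q1, q2, q3, q4, q5⟩ := H b hb hb' αbar hα θ hθ
  refine ⟨q, q1, q2, fun z hz => by rw [Real.rpow_one]; exact q3 z hz, ?_, fun _ => ⟨q4, by rw [q5, hcard]⟩⟩
  intro hn z hz h0
  have hc0 : Z.card = 0 := by omega
  rw [hc0, Set.ncard_eq_zero q4] at q5
  have : z ∈ {z : ℝ | ζ0 ^ 2 / 2 ≤ z ∧ q z = 0} := ⟨hz, h0⟩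
  rw [q5] at this
  exact this
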